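/- arXiv:0812.0020 — 4 statements merged into one kernel-verified Lean document; each statement's English description precedes it below -/
import Mathlib

section
/- Let n ≥ 1, 0 < p ≤ ∞ and 0 < r < p. There exists a constant C = C(n, p, r) > 0 such that for every ξ₀ ∈ ℝⁿ, every R > 0, and every continuous integrable function f : ℝⁿ → ℂ with f ∈ L^p(ℝⁿ) whose Fourier transform 𝓕f vanishes outside the closed ball of center ξ₀ and radius R, one has ‖ x ↦ sup_{z∈ℝⁿ} |f(x−z)|/(1+|Rz|^{n/r}) ‖_{L^p(ℝⁿ)} ≤ C ‖f‖_{L^p(ℝⁿ)}. In particular the constant C is independent of f, ξ₀ and R. -/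
open MeasureTheory FourierTransform
open scoped ENNReal NNReal

noncomputable section

/-- The `L^p` "norm" of an `ℝ≥0∞`-valued function, `0 < p ≤ ∞`. -/
def lpNormENN {E : Type*} [MeasurableSpace E] (μ : Measure E) (p : ℝ≥0∞)
    (g : E → ℝ≥0∞) : ℝ≥0∞ :=
  if p = ∞ then essSup g μ else (∫⁻ x, g x ^ p.toReal ∂μ) ^ (1 / p.toReal)

/-- The Peetre-type maximal function `sup_z |f(x-z)| / (1 + |Rz|^a)`. -/
def peetreMax {n : ℕ} (R a : ℝ) (f : EuclideanSpace ℝ (Fin n) → ℂ)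
    (x : EuclideanSpace ℝ (Fin n)) : ℝ≥0∞ :=
  ⨆ z : EuclideanSpace ℝ (Fin n), (‖f (x - z)‖₊ : ℝ≥0∞) / ENNReal.ofReal (1 + (R * ‖z‖) ^ a)

/-- polynomial weight -/
def wgt {n : ℕ} (R s : ℝ) (u : EuclideanSpace ℝ (Fin n)) : ℝ≥0∞ :=
  ENNReal.ofReal ((1 + R * ‖u‖) ^ (-s))

lemma wgt_continuous {n : ℕ} {R : ℝ} (hR : 0 < R) (s : ℝ) :
    Continuous (wgt R s : EuclideanSpace ℝ (Fin n) → ℝ≥0∞) := by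
  unfold wgt
  refine ENNReal.continuous_ofReal.comp ?_
  refine Continuous.rpow_const (by fun_prop) ?_
  intro x
  left
  positivity

lemma wgt_mass {n : ℕ} (s : ℝ) :
    ∀ (R : ℝ), 0 < R → ∀ x : EuclideanSpace ℝ (Fin n),
    ∫⁻ w, ENNReal.ofReal (R ^ n) * wgt R s (x - w) = 
      ∫⁻ u : EuclideanSpace ℝ (Fin n), wgt 1 s u := by
  intro R hR x
  rw [lintegral_sub_left_eq_self (fun u => ENNReal.ofReal (R ^ n) * wgt R s u) x]
  rw [lintegral_const_mul _ (wgt_continuous hR s).measurable]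
  have h1 : ∀ u : EuclideanSpace ℝ (Fin n), wgt R s u = wgt 1 s (R • u) := by
    intro u
    simp [wgt, norm_smul, abs_of_pos hR]
  simp_rw [h1]
  have h2 := Measure.map_addHaar_smul (volume : Measure (EuclideanSpace ℝ (Fin n))) hR.ne'
  have h3 : ∫⁻ u : EuclideanSpace ℝ (Fin n), wgt 1 s (R • u) =
      ∫⁻ u : EuclideanSpace ℝ (Fin n), wgt 1 s u ∂(Measure.map (fun u => R • u) volume) := by
    rw [lintegral_map (wgt_continuous one_pos s).measurable (measurable_const_smul R)]
  rw [h3]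
  erw [h2]
  rw [lintegral_smul_measure, smul_eq_mul, ← mul_assoc, ← ENNReal.ofReal_mul (by positivity)]
  have : R ^ n * |(R ^ Module.finrank ℝ (EuclideanSpace ℝ (Fin n)))⁻¹| = 1 := by
    rw [finrank_euclideanSpace_fin, abs_of_pos (by positivity)]
    exact mul_inv_cancel₀ (by positivity)
  rw [this]; simp

lemma wgt_mass_fin {n : ℕ} {s : ℝ} (hs : (n : ℝ) < s) :
    ∫⁻ u : EuclideanSpace ℝ (Fin n), wgt 1 s u < ∞ := by
  have := finite_integral_one_add_norm (E := EuclideanSpace ℝ (Fin n)) (μ := volume) (r := s)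
    (by simpa using hs)
  simpa [wgt] using this

/-- The abstract self-improvement inequality. -/
lemma abstract_ineq (p : ℝ) (hp : 0 < p) (C0 I : ℝ≥0∞) (hC0 : C0 ≠ ∞) (hI : I ≠ ∞) :
    ∃ C1 : ℝ≥0∞, C1 ≠ ∞ ∧ ∀ {α : Type} [MeasurableSpace α] (μ : Measure α) (g : α → ℝ≥0∞)
      (S ρ : ℝ≥0∞), Measurable g → S ≠ ∞ → (∀ w, g w ≤ S) →
      (∀ y, ∃ κ : α → ℝ≥0∞, Measurable κ ∧ (∀ w, κ w ≤ ρ) ∧ ∫⁻ w, κ w ∂μ ≤ I ∧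
        g y ≤ C0 * ∫⁻ w, g w * κ w ∂μ) → 
      (S = ⨆ y, g y) → S ^ p ≤ C1 * (ρ * ∫⁻ w, g w ^ p ∂μ) := by
  rcases le_or_gt p 1 with h1 | h1
  · refine ⟨C0, hC0, ?_⟩
    intro α _ μ g S ρ hg hS hgS hκ hSs
    by_cases hS0 : S = 0
    · simp [hS0, hp]
    have key : S ≤ S ^ (1 - p) * (C0 * (ρ * ∫⁻ w, g w ^ p ∂μ)) := by
      rw [hSs]
      refine iSup_le fun y => ?_
      rw [← hSs]
      obtain ⟨κ, hκm, hκρ, hκI, hy⟩ := hκ y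
      refine hy.trans ?_
      calc C0 * ∫⁻ w, g w * κ w ∂μ ≤ C0 * ∫⁻ w, S ^ (1 - p) * ρ * g w ^ p ∂μ := by
            refine mul_le_mul_right (lintegral_mono fun w => ?_) _
            have : g w ≤ S ^ (1 - p) * g w ^ p := by
              calc g w = g w ^ ((1 - p) + p) := by simp
                _ = g w ^ (1 - p) * g w ^ p :=
                    ENNReal.rpow_add_of_nonneg _ _ (by linarith) hp.le
                _ ≤ _ := mul_le_mul_left (ENNReal.rpow_le_rpow (hgS w) (by linarith)) _
            calc g w * κ w ≤ (S ^ (1 - p) * g w ^ p) * ρ := mul_le_mul' this (hκρ w)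
              _ = _ := by ring
        _ = _ := by rw [lintegral_const_mul _ (hg.pow_const p)]; ring
    calc S ^ p = S ^ (p - 1) * S := by
          conv_rhs => rw [← ENNReal.rpow_one S, ← ENNReal.rpow_mul, ← ENNReal.rpow_add _ _ hS0 hS]
          simp
      _ ≤ S ^ (p - 1) * (S ^ (1 - p) * (C0 * (ρ * ∫⁻ w, g w ^ p ∂μ))) := by gcongr
      _ = (S ^ (p - 1) * S ^ (1 - p)) * (C0 * (ρ * ∫⁻ w, g w ^ p ∂μ)) := by ring
      _ = _ := by rw [← ENNReal.rpow_add _ _ hS0 hS]; simp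
  · set q := p.conjExponent
    have hpq : p.HolderConjugate q := Real.HolderConjugate.conjExponent h1
    refine ⟨(C0 * I ^ (1/q)) ^ p, ?_, ?_⟩
    · refine ENNReal.rpow_ne_top_of_nonneg hp.le (ENNReal.mul_ne_top hC0 ?_)
      exact ENNReal.rpow_ne_top_of_nonneg (one_div_nonneg.2 hpq.symm.nonneg) hI
    intro α _ μ g S ρ hg hS hgS hκ hSs
    have key : S ≤ C0 * I ^ (1/q) * (ρ * ∫⁻ w, g w ^ p ∂μ) ^ (1/p) := by
      rw [hSs]
      refine iSup_le fun y => ?_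
      obtain ⟨κ, hκm, hκρ, hκI, hy⟩ := hκ y
      refine hy.trans ?_
      have hq0 : q ≠ 0 := hpq.symm.pos.ne'
      calc C0 * ∫⁻ w, g w * κ w ∂μ 
          = C0 * ∫⁻ w, ((fun w => g w * κ w ^ (1/p)) * (fun w => κ w ^ (1/q))) w ∂μ := by
            congr 2
            ext w
            simp only [Pi.mul_apply]
            rw [mul_assoc, ← ENNReal.rpow_add_of_nonneg _ _ (one_div_nonneg.2 hp.le) 
              (one_div_nonneg.2 hpq.symm.nonneg)]
            have := hpq.inv_add_inv_eq_one
            simp only [one_div, this, ENNReal.rpow_one]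
        _ ≤ C0 * ((∫⁻ w, (g w * κ w ^ (1/p)) ^ p ∂μ) ^ (1/p) * 
              (∫⁻ w, (κ w ^ (1/q)) ^ q ∂μ) ^ (1/q)) := by
            gcongr
            exact ENNReal.lintegral_mul_le_Lp_mul_Lq μ hpq 
              (hg.mul (hκm.pow_const _)).aemeasurable (hκm.pow_const _).aemeasurable
        _ ≤ C0 * ((ρ * ∫⁻ w, g w ^ p ∂μ) ^ (1/p) * I ^ (1/q)) := by
            have hh : (0:ℝ) ≤ 1/q := one_div_nonneg.2 hpq.symm.nonneg
            have hh' : (0:ℝ) ≤ 1/p := one_div_nonneg.2 hp.le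
            gcongr
            · rw [← lintegral_const_mul _ (hg.pow_const p)]
              refine lintegral_mono fun w => ?_
              rw [ENNReal.mul_rpow_of_nonneg _ _ hp.le, ← ENNReal.rpow_mul, 
                one_div_mul_cancel hp.ne', ENNReal.rpow_one, mul_comm]
              gcongr
              exact hκρ w
            · refine le_trans (le_of_eq ?_) hκI
              congr 1; ext w
              rw [← ENNReal.rpow_mul, one_div_mul_cancel hq0, ENNReal.rpow_one]
        _ = _ := by ring
    calc S ^ p ≤ (C0 * I ^ (1/q) * (ρ * ∫⁻ w, g w ^ p ∂μ) ^ (1/p)) ^ p := by gcongr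
      _ = _ := by
        rw [ENNReal.mul_rpow_of_nonneg _ _ hp.le, ← ENNReal.rpow_mul, one_div_mul_cancel hp.ne',
          ENNReal.rpow_one]


lemma repro {n : ℕ} (s : ℝ) :
    ∃ C0 : ℝ≥0∞, C0 ≠ ∞ ∧ ∀ (ξ₀ : EuclideanSpace ℝ (Fin n)) (R : ℝ), 0 < R →
        ∀ f : EuclideanSpace ℝ (Fin n) → ℂ,
          Continuous f → Integrable f volume → 
          (∀ ξ, ξ ∉ Metric.closedBall ξ₀ R → 𝓕 f ξ = 0) → ∀ y,
          ‖f y‖ₑ ≤ C0 * ∫⁻ w, ‖f w‖ₑ * (ENNReal.ofReal (R ^ n) * wgt R s (y - w)) := by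
  let χ₀ : ContDiffBump (0 : EuclideanSpace ℝ (Fin n)) := ⟨1, 2, by norm_num, by norm_num⟩
  let χ : EuclideanSpace ℝ (Fin n) → ℂ := fun x => ((χ₀ x : ℝ) : ℂ)
  have hχc : HasCompactSupport χ := χ₀.hasCompactSupport.comp_left (g := fun x : ℝ => (x : ℂ)) rfl
  have hχs : ContDiff ℝ (⊤ : ℕ∞) χ := Complex.ofRealCLM.contDiff.comp χ₀.contDiff
  let X : SchwartzMap (EuclideanSpace ℝ (Fin n)) ℂ := hχc.toSchwartzMap hχs
  have hX : ∀ x, X x = χ x := fun x => rfl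
  obtain ⟨k, hk⟩ := exists_nat_ge s
  let B : ℝ := 2 ^ k * (Finset.Iic (k, 0)).sup (fun m => SchwartzMap.seminorm ℝ m.1 m.2) (𝓕 X)
  have hB : ∀ u, ‖𝓕 χ u‖ ≤ B * (1 + ‖u‖) ^ (-s) := by
    intro u
    have h := SchwartzMap.one_add_le_sup_seminorm_apply (𝕜 := ℝ) (m := (k, 0)) (k := k) (n := 0)
      le_rfl le_rfl (𝓕 X) u
    rw [norm_iteratedFDeriv_zero, SchwartzMap.fourier_coe] at h
    change (1 + ‖u‖) ^ k * ‖𝓕 χ u‖ ≤ B at h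
    have h1 : (0:ℝ) < 1 + ‖u‖ := by positivity
    rw [Real.rpow_neg h1.le, ← div_eq_mul_inv, le_div_iff₀ (by positivity), mul_comm]
    refine le_trans ?_ h
    gcongr
    rw [← Real.rpow_natCast]
    exact Real.rpow_le_rpow_of_exponent_le (by linarith [norm_nonneg u]) hk
  refine ⟨ENNReal.ofReal B, ENNReal.ofReal_ne_top, ?_⟩
  intro ξ₀ R hR f hf hfi hsupp y
  have hFc : Continuous (𝓕 f) := by
    exact VectorFourier.fourierIntegral_continuous Real.continuous_fourierChar
      (by exact continuous_inner) hfi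
  have hFs : HasCompactSupport (𝓕 f) :=
    HasCompactSupport.intro (isCompact_closedBall ξ₀ R) hsupp
  have hFi : Integrable (𝓕 f) := hFc.integrable_of_hasCompactSupport hFs
  have hinv := congrFun (hf.fourierInv_fourier_eq hfi hFi) y
  let g : EuclideanSpace ℝ (Fin n) → ℂ := 
    fun ξ => ((Real.fourierChar (inner ℝ ξ y) : Circle) : ℂ) * χ (R⁻¹ • (ξ - ξ₀))
  have hχi : Integrable χ := hχs.continuous.integrable_of_hasCompactSupport hχc
  have hgi : Integrable g := by
    have h1 : Integrable (fun ξ => χ (R⁻¹ • (ξ - ξ₀))) :=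
      (hχi.comp_smul (inv_ne_zero hR.ne')).comp_sub_right ξ₀
    refine h1.mono ?_ ?_
    · refine Continuous.aestronglyMeasurable ?_
      have := hχs.continuous
      have h3 := Real.continuous_fourierChar
      fun_prop
    · refine Filter.Eventually.of_forall fun ξ => ?_
      exact le_of_eq (by rw [norm_mul, Circle.norm_coe, one_mul])
  have h1 : f y = ∫ ξ, 𝓕 f ξ • g ξ := by
    rw [← hinv, Real.fourierInv_eq]
    congr 1
    ext ξ
    by_cases hξ : ξ ∈ Metric.closedBall ξ₀ R
    · have : χ (R⁻¹ • (ξ - ξ₀)) = 1 := by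
        simp only [χ]
        rw [χ₀.one_of_mem_closedBall]
        · simp
        · rw [mem_closedBall_zero_iff, norm_smul, norm_inv, Real.norm_of_nonneg hR.le]
          rw [mem_closedBall_iff_norm] at hξ
          change _ ≤ (1:ℝ)
          rw [inv_mul_le_iff₀ hR]; simpa using hξ
      simp only [g, this]
      rw [Circle.smul_def, smul_eq_mul, smul_eq_mul]
      ring
    · simp [hsupp ξ hξ]
  have h2 : f y = ∫ w, f w • 𝓕 g w := by
    rw [h1]
    have := VectorFourier.integral_fourierIntegral_smul_eq_flip (L := innerₗ (EuclideanSpace ℝ (Fin n)))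
      (μ := volume) (ν := volume) Real.continuous_fourierChar continuous_inner hfi hgi
    rw [flip_innerₗ] at this
    exact this
  have h3 : ∀ w, ‖𝓕 g w‖ = R ^ n * ‖𝓕 χ (R • (w - y))‖ := by
    intro w
    have e1 : 𝓕 g w = ∫ ξ, (fun ξ => ((Real.fourierChar (-(inner ℝ ξ (w - y))) : Circle) : ℂ) * 
        χ (R⁻¹ • (ξ - ξ₀))) ξ := by
      rw [Real.fourier_eq]
      congr 1
      ext ξ
      simp only [g]
      rw [Circle.smul_def, smul_eq_mul, ← mul_assoc, ← Circle.coe_mul, ← AddChar.map_add_eq_mul,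
        inner_sub_right]
      congr 4
      ring
    have e2 : 𝓕 g w = ∫ ξ, (fun η => ((Real.fourierChar (-(inner ℝ (R • η + ξ₀) (w - y))) : Circle) : ℂ) * 
        χ η) (R⁻¹ • ξ) := by
      rw [e1, ← integral_add_right_eq_self _ ξ₀]
      congr 1
      ext ξ
      simp [smul_smul, hR.ne']
    have e4 := Measure.integral_comp_smul (volume : Measure (EuclideanSpace ℝ (Fin n)))
      (fun η => ((Real.fourierChar (-(inner ℝ (R • η + ξ₀) (w - y))) : Circle) : ℂ) * χ η) R⁻¹
    rw [e2, e4, finrank_euclideanSpace_fin]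
    have e3 : ∀ η : EuclideanSpace ℝ (Fin n), ((Real.fourierChar (-(inner ℝ (R • η + ξ₀) (w - y))) : Circle) : ℂ) * χ η =
       ((Real.fourierChar (-(inner ℝ ξ₀ (w - y))) : Circle) : ℂ) * 
        ((Real.fourierChar (-(inner ℝ η (R • (w - y)))) : Circle) • χ η) := by
      intro η
      rw [Circle.smul_def, smul_eq_mul, ← mul_assoc, ← Circle.coe_mul, ← AddChar.map_add_eq_mul,
        inner_add_left, inner_smul_left, inner_smul_right]
      congr 4
      simp
    simp_rw [e3]
    rw [integral_const_mul, ← Real.fourier_eq, norm_smul, norm_mul, Circle.norm_coe, one_mul]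
    congr 1
    simp [abs_of_pos hR]
  rw [h2]
  refine (enorm_integral_le_lintegral_enorm _).trans ?_
  rw [← lintegral_const_mul' _ _ ENNReal.ofReal_ne_top]
  refine lintegral_mono fun w => ?_
  rw [smul_eq_mul, enorm_mul]
  have h4 : ‖𝓕 g w‖ₑ ≤ ENNReal.ofReal B * (ENNReal.ofReal (R ^ n) * wgt R s (y - w)) := by
    have hB0 : 0 ≤ B := by positivity
    rw [wgt, ← ENNReal.ofReal_mul (by positivity), ← ENNReal.ofReal_mul hB0, ← ofReal_norm]
    refine ENNReal.ofReal_le_ofReal ?_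
    rw [h3]
    have := hB (R • (w - y))
    rw [norm_smul (α := ℝ), Real.norm_of_nonneg hR.le, norm_sub_rev w y] at this
    calc _ ≤ R ^ n * (B * (1 + R * ‖y - w‖) ^ (-s)) := by gcongr
      _ = _ := by ring
  calc _ ≤ ‖f w‖ₑ * (ENNReal.ofReal B * (ENNReal.ofReal (R ^ n) * wgt R s (y - w))) := by gcongr
    _ = _ := by ring


lemma wgt_le_one {n : ℕ} {R s : ℝ} (hR : 0 < R) (hs : 0 ≤ s) (u : EuclideanSpace ℝ (Fin n)) :
    wgt R s u ≤ 1 := by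
  rw [wgt, ← ENNReal.ofReal_one]
  refine ENNReal.ofReal_le_ofReal ?_
  have : 0 ≤ R * ‖u‖ := by positivity
  exact Real.rpow_le_one_of_one_le_of_nonpos (by linarith) (by linarith)

lemma wgt_rpow {n : ℕ} {R s p : ℝ} (hR : 0 < R) (hp : 0 < p) (u : EuclideanSpace ℝ (Fin n)) :
    wgt R s u ^ p = wgt R (s * p) u := by
  have : 0 < 1 + R * ‖u‖ := by positivity
  rw [wgt, wgt, ENNReal.ofReal_rpow_of_nonneg (by positivity) hp.le, ← Real.rpow_mul this.le]
  congr 2; ring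

lemma wgt_submul {n : ℕ} {R a b : ℝ} (hR : 0 < R) (ha : 0 ≤ a)
    (x y w : EuclideanSpace ℝ (Fin n)) :
    wgt R a (x - y) * wgt R (a + b) (y - w) ≤ wgt R a (x - w) * wgt R b (y - w) := by
  have h1 : 0 < 1 + R * ‖x - y‖ := by positivity
  have h2 : 0 < 1 + R * ‖y - w‖ := by positivity
  have h3 : 0 < 1 + R * ‖x - w‖ := by positivity
  simp only [wgt]
  rw [← ENNReal.ofReal_mul (by positivity), ← ENNReal.ofReal_mul (by positivity)]
  refine ENNReal.ofReal_le_ofReal ?_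
  rw [neg_add, Real.rpow_add h2, ← mul_assoc, ← Real.mul_rpow h1.le h2.le]
  gcongr ?_ * _
  refine Real.rpow_le_rpow_of_nonpos h3 ?_ (by linarith)
  have h4 : ‖x - w‖ ≤ ‖x - y‖ + ‖y - w‖ := norm_sub_le_norm_sub_add_norm_sub x y w
  have h5 := mul_le_mul_of_nonneg_left h4 hR.le
  have h6 : 0 ≤ (R * ‖x - y‖) * (R * ‖y - w‖) := by positivity
  nlinarith

lemma peetreMax_le {n : ℕ} {R a : ℝ} (hR : 0 < R) (ha : 0 ≤ a)
    (f : EuclideanSpace ℝ (Fin n) → ℂ) (x : EuclideanSpace ℝ (Fin n)) :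
    peetreMax R a f x ≤ ENNReal.ofReal (2 ^ a) * ⨆ w, ‖f w‖ₑ * wgt R a (x - w) := by
  refine iSup_le fun z => ?_
  refine le_trans ?_ (mul_le_mul_right (le_iSup (fun w => ‖f w‖ₑ * wgt R a (x - w)) (x - z)) _)
  have ht : 0 ≤ R * ‖z‖ := by positivity
  set t := R * ‖z‖ with htd
  have h1 : (1 + t ^ a)⁻¹ ≤ 2 ^ a * (1 + t) ^ (-a) := by
    rw [Real.rpow_neg (by positivity), ← div_eq_mul_inv, inv_eq_one_div,
      div_le_div_iff₀ (by positivity) (by positivity), one_mul]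
    rcases le_total t 1 with h | h
    · calc (1 + t) ^ a ≤ 2 ^ a := by gcongr; linarith
        _ ≤ 2 ^ a * (1 + t ^ a) := by
          have : 0 ≤ t ^ a := by positivity
          nlinarith [Real.rpow_pos_of_pos (two_pos) a]
    · calc (1 + t) ^ a ≤ (2 * t) ^ a := by gcongr; linarith
        _ = 2 ^ a * t ^ a := Real.mul_rpow (by norm_num) ht
        _ ≤ 2 ^ a * (1 + t ^ a) := by gcongr; linarith
  rw [sub_sub_cancel, wgt, ← htd, div_eq_mul_inv, ← ENNReal.ofReal_inv_of_pos (by positivity)]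
  calc ‖f (x - z)‖ₑ * ENNReal.ofReal (1 + t ^ a)⁻¹
      ≤ ‖f (x - z)‖ₑ * ENNReal.ofReal (2 ^ a * (1 + t) ^ (-a)) := by gcongr
    _ = _ := by rw [ENNReal.ofReal_mul (by positivity)]; ring

lemma peetre_top {n : ℕ} (R a : ℝ) (hR : 0 < R)
    (f : EuclideanSpace ℝ (Fin n) → ℂ) (hf : Continuous f) :
    essSup (peetreMax R a f) volume ≤ eLpNorm f ∞ volume := by
  have hb : ∀ y, ‖f y‖ₑ ≤ eLpNorm f ∞ volume := by
    intro y
    rw [eLpNorm_exponent_top]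
    have h1 : ∀ᵐ y, ‖f y‖ₑ ≤ eLpNormEssSup f volume := enorm_ae_le_eLpNormEssSup f volume
    have hcl : IsClosed {y | ‖f y‖ₑ ≤ eLpNormEssSup f volume} :=
      isClosed_le (by fun_prop) continuous_const
    have hd : Dense {y | ‖f y‖ₑ ≤ eLpNormEssSup f volume} := Measure.dense_of_ae h1
    have : y ∈ closure {y | ‖f y‖ₑ ≤ eLpNormEssSup f volume} := hd y
    rwa [hcl.closure_eq] at this
  refine essSup_le_of_ae_le _ (Filter.Eventually.of_forall fun x => ?_)
  refine iSup_le fun z => ?_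
  refine le_trans ?_ (hb (x - z))
  refine ENNReal.div_le_of_le_mul ?_
  refine le_mul_of_one_le_right' ?_
  rw [← ENNReal.ofReal_one]
  refine ENNReal.ofReal_le_ofReal ?_
  have : 0 ≤ (R * ‖z‖) ^ a := by positivity
  linarith

lemma peetre_fin {n : ℕ} (p : ℝ) (hp : 0 < p) (a : ℝ) (ha : 0 ≤ a) (hap : n < a * p) :
    ∃ C : ℝ≥0∞, C ≠ ∞ ∧
      ∀ (ξ₀ : EuclideanSpace ℝ (Fin n)) (R : ℝ), 0 < R →
        ∀ f : EuclideanSpace ℝ (Fin n) → ℂ,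
          Continuous f → Integrable f volume →
          (∀ ξ, ξ ∉ Metric.closedBall ξ₀ R → 𝓕 f ξ = 0) →
          ∫⁻ x, peetreMax R a f x ^ p ≤ C * ∫⁻ x, ‖f x‖ₑ ^ p := by
  have hb0 : (0 : ℝ) ≤ n + 1 := by positivity
  obtain ⟨C0, hC0, hrep⟩ := repro (n := n) (a + (n + 1))
  have hI := wgt_mass_fin (n := n) (s := n + 1) (by linarith)
  have hJ := wgt_mass_fin (n := n) (s := a * p) hap
  set I := ∫⁻ u : EuclideanSpace ℝ (Fin n), wgt 1 (n + 1) u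
  set J := ∫⁻ u : EuclideanSpace ℝ (Fin n), wgt 1 (a * p) u
  obtain ⟨C1, hC1, habs⟩ := abstract_ineq p hp C0 I hC0 hI.ne
  refine ⟨ENNReal.ofReal (2 ^ a) ^ p * (C1 * J), ?_, ?_⟩
  · exact ENNReal.mul_ne_top (ENNReal.rpow_ne_top_of_nonneg hp.le ENNReal.ofReal_ne_top)
      (ENNReal.mul_ne_top hC1 hJ.ne)
  intro ξ₀ R hR f hf hfi hsupp
  set ρ := ENNReal.ofReal (R ^ n) with hρ
  have hfm : Measurable fun w => ‖f w‖ₑ := hf.measurable.enorm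
  have hW : ∀ s, Measurable (wgt R s : EuclideanSpace ℝ (Fin n) → ℝ≥0∞) :=
    fun s => (wgt_continuous hR s).measurable
  have hbd : ∀ y, ‖f y‖ₑ ≤ C0 * (ρ * ∫⁻ w, ‖f w‖ₑ) := by
    intro y
    refine (hrep ξ₀ R hR f hf hfi hsupp y).trans ?_
    rw [← lintegral_const_mul _ hfm]
    refine mul_le_mul_right (lintegral_mono fun w => ?_) _
    rw [mul_comm]
    refine mul_le_mul_left ?_ _
    exact mul_le_of_le_one_right' (wgt_le_one hR (by positivity) _)
  have hbfin : C0 * (ρ * ∫⁻ w, ‖f w‖ₑ) ≠ ∞ :=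
    ENNReal.mul_ne_top hC0 (ENNReal.mul_ne_top ENNReal.ofReal_ne_top hfi.2.ne)
  have hpt : ∀ x, (⨆ w, ‖f w‖ₑ * wgt R a (x - w)) ^ p ≤
      C1 * (ρ * ∫⁻ w, (‖f w‖ₑ * wgt R a (x - w)) ^ p) := by
    intro x
    refine habs volume (fun w => ‖f w‖ₑ * wgt R a (x - w)) _ ρ ?_ ?_ ?_ ?_ rfl
    · exact hfm.mul ((hW a).comp (measurable_const.sub measurable_id))
    · refine ne_top_of_le_ne_top hbfin (iSup_le fun w => ?_)
      exact (mul_le_of_le_one_right' (wgt_le_one hR ha _)).trans (hbd w)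
    · exact fun w => le_iSup (fun w => ‖f w‖ₑ * wgt R a (x - w)) w
    · intro y
      refine ⟨fun w => ρ * wgt R (n + 1) (y - w), ?_, ?_, ?_, ?_⟩
      · exact measurable_const.mul ((hW _).comp (measurable_const.sub measurable_id))
      · exact fun w => mul_le_of_le_one_right' (wgt_le_one hR hb0 _)
      · exact (wgt_mass _ R hR y).le
      · have hfin : wgt R a (x - y) ≠ ∞ := ENNReal.ofReal_ne_top
        calc ‖f y‖ₑ * wgt R a (x - y)
            ≤ (C0 * ∫⁻ w, ‖f w‖ₑ * (ρ * wgt R (a + (n + 1)) (y - w))) * wgt R a (x - y) := by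
              gcongr
              exact hrep ξ₀ R hR f hf hfi hsupp y
          _ = C0 * ∫⁻ w, ‖f w‖ₑ * (ρ * wgt R (a + (n + 1)) (y - w)) * wgt R a (x - y) := by
              rw [lintegral_mul_const' _ _ hfin, mul_assoc]
          _ ≤ _ := by
              refine mul_le_mul_right (lintegral_mono fun w => ?_) _
              calc ‖f w‖ₑ * (ρ * wgt R (a + (n + 1)) (y - w)) * wgt R a (x - y)
                  = ‖f w‖ₑ * ρ * (wgt R a (x - y) * wgt R (a + (n + 1)) (y - w)) := by ring
                _ ≤ ‖f w‖ₑ * ρ * (wgt R a (x - w) * wgt R (n + 1) (y - w)) :=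
                    mul_le_mul_right (wgt_submul hR ha x y w) _
                _ = _ := by ring
  have hmeas : Measurable (Function.uncurry fun x w : EuclideanSpace ℝ (Fin n) =>
      ‖f w‖ₑ ^ p * (ρ * wgt R (a * p) (x - w))) := by
    refine Measurable.mul ((hfm.comp measurable_snd).pow_const p) (Measurable.const_mul ?_ ρ)
    exact (hW _).comp (measurable_fst.sub measurable_snd)
  have hsymm : ∀ x w : EuclideanSpace ℝ (Fin n), wgt R (a * p) (x - w) = wgt R (a * p) (w - x) := by
    intro x w
    simp [wgt, norm_sub_rev]
  calc ∫⁻ x, peetreMax R a f x ^ p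
      ≤ ∫⁻ x, ENNReal.ofReal (2 ^ a) ^ p *
          (C1 * ∫⁻ w, ‖f w‖ₑ ^ p * (ρ * wgt R (a * p) (x - w))) := by
        refine lintegral_mono fun x => ?_
        calc peetreMax R a f x ^ p
            ≤ (ENNReal.ofReal (2 ^ a) * ⨆ w, ‖f w‖ₑ * wgt R a (x - w)) ^ p :=
              ENNReal.rpow_le_rpow (peetreMax_le hR ha f x) hp.le
          _ = ENNReal.ofReal (2 ^ a) ^ p * (⨆ w, ‖f w‖ₑ * wgt R a (x - w)) ^ p :=
              ENNReal.mul_rpow_of_nonneg _ _ hp.le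
          _ ≤ ENNReal.ofReal (2 ^ a) ^ p * (C1 * (ρ * ∫⁻ w, (‖f w‖ₑ * wgt R a (x - w)) ^ p)) :=
              mul_le_mul_right (hpt x) _
          _ = _ := by
              rw [← lintegral_const_mul' _ _ ENNReal.ofReal_ne_top]
              congr 3
              ext w
              rw [ENNReal.mul_rpow_of_nonneg _ _ hp.le, wgt_rpow hR hp]
              ring
    _ = ENNReal.ofReal (2 ^ a) ^ p *
          (C1 * ∫⁻ x, ∫⁻ w, ‖f w‖ₑ ^ p * (ρ * wgt R (a * p) (x - w))) := by
        rw [lintegral_const_mul' _ _ (ENNReal.rpow_ne_top_of_nonneg hp.le ENNReal.ofReal_ne_top),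
          lintegral_const_mul' _ _ hC1]
    _ = ENNReal.ofReal (2 ^ a) ^ p * (C1 * ∫⁻ w, ‖f w‖ₑ ^ p * J) := by
        rw [lintegral_lintegral_swap hmeas.aemeasurable]
        congr 3
        ext w
        have hm : Measurable fun x : EuclideanSpace ℝ (Fin n) => ρ * wgt R (a * p) (x - w) :=
          measurable_const.mul ((hW _).comp (measurable_id.sub measurable_const))
        rw [lintegral_const_mul _ hm]
        congr 1
        simp_rw [hsymm _ w]
        exact wgt_mass _ R hR w
    _ = _ := by
        rw [lintegral_mul_const' _ _ hJ.ne]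
        ring

/-- **Triebel.** Let `n ≥ 1`, `0 < p ≤ ∞`, `0 < r < p`. There is a constant
`C = C(n,p,r)` such that for every `ξ₀ ∈ ℝⁿ`, `R > 0` and continuous integrable `f ∈ Lᵖ`
whose Fourier transform vanishes outside the closed ball `B(ξ₀, R)`,
`‖sup_z |f(·-z)|/(1+|Rz|^{n/r})‖_{L^p} ≤ C ‖f‖_{L^p}`. -/
theorem peetre_maximal_inequality
    (n : ℕ) (hn : 1 ≤ n) (p : ℝ≥0∞) (hp : 0 < p) (r : ℝ) (hr : 0 < r)
    (hrp : ENNReal.ofReal r < p) :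
    ∃ C : ℝ≥0∞, 0 < C ∧ C ≠ ∞ ∧
      ∀ (ξ₀ : EuclideanSpace ℝ (Fin n)) (R : ℝ), 0 < R →
        ∀ f : EuclideanSpace ℝ (Fin n) → ℂ,
          Continuous f → Integrable f volume → eLpNorm f p volume < ∞ →
          (∀ ξ, ξ ∉ Metric.closedBall ξ₀ R → 𝓕 f ξ = 0) →
          lpNormENN volume p (peetreMax R ((n : ℝ) / r) f) ≤ C * eLpNorm f p volume := by
  by_cases hpt : p = ∞
  · subst hpt
    refine ⟨1, one_pos, ENNReal.one_ne_top, ?_⟩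
    intro ξ₀ R hR f hf hfi hfp hsupp
    rw [lpNormENN, if_pos rfl, one_mul]
    exact peetre_top R _ hR f hf
  · have hp' : 0 < p.toReal := ENNReal.toReal_pos hp.ne' hpt
    have hrp' : r < p.toReal := (ENNReal.ofReal_lt_iff_lt_toReal hr.le hpt).1 hrp
    have hn0 : (0 : ℝ) < n := by exact_mod_cast hn
    have hap : (n : ℝ) < (n : ℝ) / r * p.toReal := by
      rw [div_mul_eq_mul_div, lt_div_iff₀ hr]
      exact mul_lt_mul_of_pos_left hrp' hn0
    obtain ⟨C, hC, h⟩ := peetre_fin (n := n) p.toReal hp' ((n : ℝ) / r) (by positivity) hap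
    refine ⟨C ^ (1 / p.toReal) + 1, by simp, ?_, ?_⟩
    · exact ENNReal.add_ne_top.2
        ⟨ENNReal.rpow_ne_top_of_nonneg (by positivity) hC, ENNReal.one_ne_top⟩
    intro ξ₀ R hR f hf hfi hfp hsupp
    rw [lpNormENN, if_neg hpt, eLpNorm_eq_lintegral_rpow_enorm_toReal hp.ne' hpt]
    refine (ENNReal.rpow_le_rpow (h ξ₀ R hR f hf hfi hsupp) (by positivity)).trans ?_
    rw [ENNReal.mul_rpow_of_nonneg _ _ (by positivity)]
    exact mul_le_mul_left le_self_add _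
end
end

section
/- Let n ≥ 1 and 0 < p ≤ 1. There exists a constant C = C(n, p) > 0 such that for every x₀ ∈ ℝⁿ, every R > 0, and all continuous integrable functions f, g : ℝⁿ → ℂ with f, g ∈ L^p(ℝⁿ) whose Fourier transforms 𝓕f and 𝓕g vanish outside the closed ball of center x₀ and radius R, the convolution satisfies ‖f ∗ g‖_{L^p(ℝⁿ)} ≤ C R^{n(1/p − 1)} ‖f‖_{L^p(ℝⁿ)} ‖g‖_{L^p(ℝⁿ)}. The constant C is independent of x₀ and R. -/
open MeasureTheory FourierTransform
open scoped ENNReal NNReal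

noncomputable section

/-- The convolution `(f ∗ g)(x) = ∫ f(x-y) g(y) dy`. -/
def conv {n : ℕ} (f g : EuclideanSpace ℝ (Fin n) → ℂ)
    (x : EuclideanSpace ℝ (Fin n)) : ℂ :=
  ∫ y, f (x - y) * g y

/-- The Fourier transform of a band-limited integrable function is integrable. -/
lemma bl_integrable_fourier {n : ℕ} {f : EuclideanSpace ℝ (Fin n) → ℂ}
    {x₀ : EuclideanSpace ℝ (Fin n)} {R : ℝ} (hi : Integrable f volume)
    (hf : ∀ ξ, ξ ∉ Metric.closedBall x₀ R → 𝓕 f ξ = 0) : Integrable (𝓕 f) volume := by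
  have hc : Continuous (𝓕 f) :=
    VectorFourier.fourierIntegral_continuous Real.continuous_fourierChar
      (by exact continuous_inner) hi
  refine hc.integrable_of_hasCompactSupport ?_
  exact HasCompactSupport.intro (isCompact_closedBall x₀ R) hf

/-- Sup bound for band-limited functions. -/
lemma bl_sup {n : ℕ} {f : EuclideanSpace ℝ (Fin n) → ℂ}
    {x₀ : EuclideanSpace ℝ (Fin n)} {R : ℝ} (hc : Continuous f) (hi : Integrable f volume)
    (hf : ∀ ξ, ξ ∉ Metric.closedBall x₀ R → 𝓕 f ξ = 0) (y : EuclideanSpace ℝ (Fin n)) :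
    ‖f y‖ₑ ≤ volume (Metric.closedBall x₀ R) * ∫⁻ z, ‖f z‖ₑ := by
  have h1 := congrFun (hc.fourierInv_fourier_eq hi (bl_integrable_fourier hi hf)) y
  rw [← h1, Real.fourierInv_eq]
  refine (enorm_integral_le_lintegral_enorm _).trans ?_
  have h2 : ∀ v, ‖Real.fourierChar (inner ℝ v y) • 𝓕 f v‖ₑ ≤
      (Metric.closedBall x₀ R).indicator (fun _ => ∫⁻ z, ‖f z‖ₑ) v := by
    intro v
    by_cases hv : v ∈ Metric.closedBall x₀ R
    · rw [Set.indicator_of_mem hv]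
      have : ‖Real.fourierChar (inner ℝ v y) • 𝓕 f v‖ₑ = ‖𝓕 f v‖ₑ := by
        rw [← ofReal_norm, Circle.norm_smul, ofReal_norm]
      rw [this, Real.fourier_eq]
      refine (enorm_integral_le_lintegral_enorm _).trans (le_of_eq ?_)
      refine lintegral_congr fun z => ?_
      rw [← ofReal_norm, Circle.norm_smul, ofReal_norm]
    · rw [hf v hv]; simp
  refine (lintegral_mono h2).trans ?_
  rw [lintegral_indicator Metric.isClosed_closedBall.measurableSet, setLIntegral_const, mul_comm]

/-- Nikolskii inequality. -/
lemma bl_nikolskii {n : ℕ} {f : EuclideanSpace ℝ (Fin n) → ℂ}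
    {x₀ : EuclideanSpace ℝ (Fin n)} {R : ℝ} (hc : Continuous f) (hi : Integrable f volume)
    (hf : ∀ ξ, ξ ∉ Metric.closedBall x₀ R → 𝓕 f ξ = 0) {q : ℝ} (hq : 0 < q) (hq1 : q ≤ 1) :
    (∫⁻ z, ‖f z‖ₑ) ^ q ≤ volume (Metric.closedBall x₀ R) ^ (1 - q) * ∫⁻ z, ‖f z‖ₑ ^ q := by
  set A := ∫⁻ z, ‖f z‖ₑ with hA
  set M := volume (Metric.closedBall x₀ R) with hM
  have hAt : A ≠ ∞ := hi.2.ne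
  rcases eq_or_ne A 0 with h0 | h0
  · rw [h0, ENNReal.zero_rpow_of_pos hq]; exact zero_le
  have hq' : 0 ≤ 1 - q := by linarith
  have key : A ≤ (M * A) ^ (1 - q) * ∫⁻ z, ‖f z‖ₑ ^ q := by
    rw [← lintegral_const_mul _ (by fun_prop)]
    refine lintegral_mono fun z => ?_
    calc ‖f z‖ₑ = ‖f z‖ₑ ^ (1 - q) * ‖f z‖ₑ ^ q := by
          rw [← ENNReal.rpow_add_of_nonneg _ _ hq' hq.le]; simp
      _ ≤ _ := by
          gcongr
          exact bl_sup hc hi hf z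
  have hne : A ^ (1 - q) ≠ 0 := by
    simp [ENNReal.rpow_eq_zero_iff, h0, hAt]
  have hnt : A ^ (1 - q) ≠ ∞ := ENNReal.rpow_ne_top_of_nonneg hq' hAt
  refine (ENNReal.mul_le_mul_iff_right hne hnt).1 ?_
  rw [← ENNReal.rpow_add_of_nonneg _ _ hq' hq.le]
  calc A ^ (1 - q + q) = A := by simp
    _ ≤ _ := key
    _ = _ := by rw [ENNReal.mul_rpow_of_nonneg _ _ hq']; ring

/-- The product `y ↦ f (x - y) g y` is band-limited. -/
lemma bl_prod {n : ℕ} {f g : EuclideanSpace ℝ (Fin n) → ℂ}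
    {x₀ : EuclideanSpace ℝ (Fin n)} {R : ℝ} (hc : Continuous f) (hi : Integrable f volume)
    (hgi : Integrable g volume)
    (hf : ∀ ξ, ξ ∉ Metric.closedBall x₀ R → 𝓕 f ξ = 0)
    (hg : ∀ ξ, ξ ∉ Metric.closedBall x₀ R → 𝓕 g ξ = 0) (x ξ : EuclideanSpace ℝ (Fin n))
    (hξ : ξ ∉ Metric.closedBall (0 : EuclideanSpace ℝ (Fin n)) (2 * R)) :
    𝓕 (fun y => f (x - y) * g y) ξ = 0 := by
  have hFi := bl_integrable_fourier hi hf
  set F : EuclideanSpace ℝ (Fin n) → ℂ := fun η => Real.fourierChar (inner ℝ η x) • 𝓕 f η with hF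
  set G : EuclideanSpace ℝ (Fin n) → ℂ := fun y => Real.fourierChar (-inner ℝ y ξ) • g y with hG
  have hF1 : Integrable F volume := by
    have := (Real.fourierIntegral_convergent_iff (μ := volume) (-x)).2 hFi
    simpa [hF] using this
  have hG1 : Integrable G volume := (Real.fourierIntegral_convergent_iff (μ := volume) ξ).2 hgi
  have e1 : ∀ y, f (x - y) = 𝓕 F y := by
    intro y
    rw [← congrFun (hc.fourierInv_fourier_eq hi hFi) (x - y), Real.fourierInv_eq, Real.fourier_eq]
    refine integral_congr_ae (.of_forall fun v => ?_)
    simp only [hF, smul_smul, ← AddChar.map_add_eq_mul]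
    rw [inner_sub_right, sub_eq_add_neg, add_comm]
  have e2 : ∀ η, 𝓕 G η = 𝓕 g (η + ξ) := by
    intro η
    rw [Real.fourier_eq, Real.fourier_eq]
    refine integral_congr_ae (.of_forall fun v => ?_)
    simp only [hG, smul_smul, ← AddChar.map_add_eq_mul]
    rw [inner_add_right, neg_add]
  have e3 : 𝓕 (fun y => f (x - y) * g y) ξ = ∫ y, 𝓕 F y • G y := by
    rw [Real.fourier_eq]
    refine integral_congr_ae (.of_forall fun v => ?_)
    simp only [hG, e1, smul_eq_mul, mul_smul_comm]
  have e4 : ∫ y, 𝓕 F y • G y = ∫ η, F η • 𝓕 G η := by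
    have := VectorFourier.integral_fourierIntegral_smul_eq_flip (L := innerₗ _)
      (μ := volume) (ν := volume) Real.continuous_fourierChar
      (by exact continuous_inner) hF1 hG1
    rw [flip_innerₗ] at this
    exact this
  rw [e3, e4]
  refine integral_eq_zero_of_ae (.of_forall fun η => ?_)
  simp only [Pi.zero_apply, e2]
  by_cases h1 : η ∈ Metric.closedBall x₀ R
  · rw [hg, smul_zero]
    intro h2
    apply hξ
    rw [mem_closedBall_iff_norm] at *
    calc ‖ξ - 0‖ = ‖(η + ξ - x₀) - (η - x₀)‖ := by congr 1; abel
      _ ≤ ‖η + ξ - x₀‖ + ‖η - x₀‖ := norm_sub_le _ _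
      _ ≤ 2 * R := by linarith
  · simp [hF, hf η h1]

lemma bl_conv {n : ℕ} {f g : EuclideanSpace ℝ (Fin n) → ℂ}
    {x₀ : EuclideanSpace ℝ (Fin n)} {R : ℝ} (hc : Continuous f) (hi : Integrable f volume)
    (hgc : Continuous g) (hgi : Integrable g volume)
    (hf : ∀ ξ, ξ ∉ Metric.closedBall x₀ R → 𝓕 f ξ = 0)
    (hg : ∀ ξ, ξ ∉ Metric.closedBall x₀ R → 𝓕 g ξ = 0) {q : ℝ} (hq : 0 < q) (hq1 : q ≤ 1) :
    ∫⁻ x, ‖conv f g x‖ₑ ^ q ≤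
      volume (Metric.closedBall (0 : EuclideanSpace ℝ (Fin n)) (2 * R)) ^ (1 - q) *
        ((∫⁻ x, ‖f x‖ₑ ^ q) * ∫⁻ x, ‖g x‖ₑ ^ q) := by
  set M := volume (Metric.closedBall (0 : EuclideanSpace ℝ (Fin n)) (2 * R)) with hM
  obtain ⟨B, hB⟩ : ∃ B : ℝ, ∀ y, ‖f y‖ ≤ B := by
    refine ⟨(volume (Metric.closedBall x₀ R) * ∫⁻ z, ‖f z‖ₑ).toReal, fun y => ?_⟩
    rw [← toReal_enorm]
    exact ENNReal.toReal_mono (ENNReal.mul_ne_top measure_closedBall_lt_top.ne hi.2.ne)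
      (bl_sup hc hi hf y)
  have h1 : ∀ x, ‖conv f g x‖ₑ ^ q ≤ M ^ (1 - q) * ∫⁻ y, ‖f (x - y)‖ₑ ^ q * ‖g y‖ₑ ^ q := by
    intro x
    have hcx : Continuous (fun y => f (x - y) * g y) := by fun_prop
    have hix : Integrable (fun y => f (x - y) * g y) volume :=
      hgi.bdd_mul (c := B) (by fun_prop : Continuous fun y => f (x - y)).aestronglyMeasurable
        (.of_forall fun y => hB _)
    calc ‖conv f g x‖ₑ ^ q ≤ (∫⁻ y, ‖f (x - y) * g y‖ₑ) ^ q := by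
          gcongr
          exact enorm_integral_le_lintegral_enorm _
      _ ≤ M ^ (1 - q) * ∫⁻ y, ‖f (x - y) * g y‖ₑ ^ q :=
          bl_nikolskii hcx hix (fun ξ hξ => bl_prod hc hi hgi hf hg x ξ hξ) hq hq1
      _ = _ := by simp_rw [enorm_mul, ENNReal.mul_rpow_of_nonneg _ _ hq.le]
  refine (lintegral_mono h1).trans (le_of_eq ?_)
  have hMt : M ^ (1 - q) ≠ ∞ :=
    ENNReal.rpow_ne_top_of_nonneg (by linarith) measure_closedBall_lt_top.ne
  rw [lintegral_const_mul' _ _ hMt]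
  congr 1
  rw [lintegral_lintegral_swap (by
    apply Measurable.aemeasurable
    apply Measurable.mul
    · exact ((by fun_prop : Continuous fun z : EuclideanSpace ℝ (Fin n) × EuclideanSpace ℝ (Fin n)
        => f (z.1 - z.2)).measurable.enorm).pow_const q
    · exact ((by fun_prop : Continuous fun z : EuclideanSpace ℝ (Fin n) × EuclideanSpace ℝ (Fin n)
        => g z.2).measurable.enorm).pow_const q)]
  have h2 : ∀ y, ∫⁻ x, ‖f (x - y)‖ₑ ^ q * ‖g y‖ₑ ^ q = (∫⁻ x, ‖f x‖ₑ ^ q) * ‖g y‖ₑ ^ q := by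
    intro y
    rw [lintegral_mul_const _ ((by fun_prop : Continuous fun x => f (x - y)).measurable.enorm.pow_const q),
      lintegral_sub_right_eq_self (fun x => ‖f x‖ₑ ^ q) y]
  simp_rw [h2]
  rw [lintegral_const_mul _ (by fun_prop)]

/-- Let `n ≥ 1` and `0 < p ≤ 1`. There is `C = C(n,p)` such that for every
`x₀ ∈ ℝⁿ`, `R > 0` and continuous integrable `f, g ∈ Lᵖ` whose Fourier transforms vanish
outside the closed ball `B(x₀, R)`, one has
`‖f ∗ g‖_{L^p} ≤ C R^{n(1/p - 1)} ‖f‖_{L^p} ‖g‖_{L^p}`. -/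
theorem convolution_band_limited_Lp
    (n : ℕ) (hn : 1 ≤ n) (p : ℝ≥0∞) (hp : 0 < p) (hp1 : p ≤ 1) :
    ∃ C : ℝ≥0∞, 0 < C ∧ C ≠ ∞ ∧
      ∀ (x₀ : EuclideanSpace ℝ (Fin n)) (R : ℝ), 0 < R →
        ∀ f g : EuclideanSpace ℝ (Fin n) → ℂ,
          Continuous f → Integrable f volume → eLpNorm f p volume < ∞ →
          Continuous g → Integrable g volume → eLpNorm g p volume < ∞ →
          (∀ ξ, ξ ∉ Metric.closedBall x₀ R → 𝓕 f ξ = 0) →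
          (∀ ξ, ξ ∉ Metric.closedBall x₀ R → 𝓕 g ξ = 0) →
          eLpNorm (conv f g) p volume ≤
            C * ENNReal.ofReal (R ^ ((n : ℝ) * (1 / p.toReal - 1))) *
              eLpNorm f p volume * eLpNorm g p volume := by
  have hpt : p ≠ ∞ := (hp1.trans_lt ENNReal.one_lt_top).ne
  have hq : 0 < p.toReal := ENNReal.toReal_pos hp.ne' hpt
  have hq1 : p.toReal ≤ 1 := by
    simpa using ENNReal.toReal_mono ENNReal.one_ne_top hp1
  have hs : 0 ≤ 1 / p.toReal - 1 := by
    rw [sub_nonneg, le_div_iff₀ hq]; linarith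
  set V := volume (Metric.ball (0 : EuclideanSpace ℝ (Fin n)) 1) with hV
  have hV0 : V ≠ 0 := (Metric.measure_ball_pos volume _ one_pos).ne'
  have hVt : V ≠ ∞ := measure_ball_lt_top.ne
  have hW0 : ENNReal.ofReal (2 ^ n) * V ≠ 0 := by
    refine mul_ne_zero ?_ hV0
    simp
  have hWt : ENNReal.ofReal (2 ^ n) * V ≠ ∞ := ENNReal.mul_ne_top ENNReal.ofReal_ne_top hVt
  refine ⟨(ENNReal.ofReal (2 ^ n) * V) ^ (1 / p.toReal - 1),
    ENNReal.rpow_pos hW0.bot_lt hWt, ENNReal.rpow_ne_top_of_nonneg hs hWt, ?_⟩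
  intro x₀ R hR f g hc hi _ hgc hgi _ hf hg
  have key := bl_conv hc hi hgc hgi hf hg hq hq1
  have hM : volume (Metric.closedBall (0 : EuclideanSpace ℝ (Fin n)) (2 * R)) =
      (ENNReal.ofReal (2 ^ n) * V) * ENNReal.ofReal (R ^ n) := by
    rw [Measure.addHaar_closedBall _ _ (by positivity), finrank_euclideanSpace_fin, mul_pow,
      ENNReal.ofReal_mul (by positivity)]
    ring
  have hq' : 0 ≤ 1 / p.toReal := by positivity
  have hRr : ENNReal.ofReal (R ^ ((n : ℝ) * (1 / p.toReal - 1))) =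
      ENNReal.ofReal (R ^ n) ^ (1 / p.toReal - 1) := by
    rw [ENNReal.ofReal_rpow_of_nonneg (by positivity) hs, Real.rpow_mul hR.le, Real.rpow_natCast]
  simp only [eLpNorm_eq_lintegral_rpow_enorm_toReal hp.ne' hpt]
  refine (ENNReal.rpow_le_rpow key hq').trans (le_of_eq ?_)
  rw [ENNReal.mul_rpow_of_nonneg _ _ hq', ENNReal.mul_rpow_of_nonneg _ _ hq', ← ENNReal.rpow_mul,
    hRr, hM, ← ENNReal.mul_rpow_of_nonneg _ _ hs]
  have hexp : (1 - p.toReal) * (1 / p.toReal) = 1 / p.toReal - 1 := by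
    field_simp
  rw [hexp]
  ring
end
end

section
/- Let n ≥ 1 and 0 < α < 1. For k ∈ ℤⁿ and r > 0 let Q_k(r) be the cube with center |k|^{α/(1−α)} k and side length 2r⟨k⟩^{α/(1−α)}. Then there exists r₁ > 0 such that for every r > r₁: (i) ⋃_{k∈ℤⁿ} Q_k(r) = ℝⁿ; (ii) there exists n₀ ∈ ℕ such that every point of ℝⁿ (equivalently, every cube Q_k(r)) meets at most n₀ of the cubes Q_l(r); (iii) there exist constants 0 < c ≤ C such that for every k ∈ ℤⁿ and every ξ ∈ Q_k(r), c⟨ξ⟩ ≤ ⟨k⟩^{1/(1−α)} ≤ C⟨ξ⟩, so that the Lebesgue measure satisfies |Q_k(r)| ≍ ⟨ξ⟩^{nα} uniformly for ξ ∈ Q_k(r). -/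
open MeasureTheory
open scoped ENNReal NNReal

noncomputable section

/-- Japanese bracket `⟨k⟩ = (1+|k|²)^{1/2}` of an integer vector. -/
def jbr {d : ℕ} (k : Fin d → ℤ) : ℝ := (1 + ∑ i, ((k i : ℝ))^2) ^ ((1:ℝ)/2)

/-- The `i`-th coordinate of the center `|k|^{α/(1-α)} k` of the cube `Q_k`. -/
def alphaCenter (α : ℝ) {d : ℕ} (k : Fin d → ℤ) (i : Fin d) : ℝ :=
  Real.sqrt (∑ j, ((k j : ℝ))^2) ^ (α/(1-α)) * k i

/-- The cube `Q_k(r)` with center `|k|^{α/(1-α)} k` and side length `2r⟨k⟩^{α/(1-α)}`. -/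
def alphaCube (α : ℝ) {d : ℕ} (k : Fin d → ℤ) (r : ℝ) : Set (EuclideanSpace ℝ (Fin d)) :=
  {ξ | ∀ i, |ξ i - alphaCenter α k i| ≤ r * jbr k ^ (α/(1-α))}

lemma F_mono {E : Type*} [NormedAddCommGroup E] [InnerProductSpace ℝ E] (β : ℝ) (hβ : 0 < β)
    (x y : E) (h : ‖y‖ ≤ ‖x‖) :
    ‖x‖ ^ β * ‖x - y‖ ≤ 2 * ‖‖x‖ ^ β • x - ‖y‖ ^ β • y‖ := by
  have hb : ‖y‖ ^ β ≤ ‖x‖ ^ β := Real.rpow_le_rpow (norm_nonneg _) h hβ.le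
  have hb0 : 0 ≤ ‖y‖ ^ β := Real.rpow_nonneg (norm_nonneg _) _
  set A := ‖x‖ ^ β
  set B := ‖y‖ ^ β
  have h1 := real_inner_le_norm (A • x - B • y) (x - y)
  have h2 : inner ℝ (A • x - B • y) (x - y) = (A + B) / 2 * ‖x - y‖ ^ 2
      + (A - B) * (‖x‖ ^ 2 - ‖y‖ ^ 2) / 2 := by
    rw [norm_sub_sq_real, inner_sub_left, inner_sub_right, inner_sub_right]
    simp only [inner_smul_left, real_inner_self_eq_norm_sq, real_inner_comm x y]
    simp
    ring
  have h3 : 0 ≤ (A - B) * (‖x‖ ^ 2 - ‖y‖ ^ 2) :=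
    mul_nonneg (by linarith) (by nlinarith [norm_nonneg x, norm_nonneg y])
  rcases (norm_nonneg (x - y)).eq_or_lt with h0 | h0
  · rw [← h0]; simp
  · refine le_of_mul_le_mul_right ?_ h0
    nlinarith [mul_nonneg hb0 (sq_nonneg ‖x - y‖)]

lemma pow_diff (β a b : ℝ) (hβ : 0 < β) (ha : 0 ≤ a) (hab : a ≤ b) :
    b * (b ^ β - a ^ β) ≤ (1 + β) * b ^ β * (b - a) := by
  rcases (ha.trans hab).eq_or_lt with h0 | h0
  · have : a = 0 := by linarith
    subst this; subst h0; simp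
  have h1 := one_add_mul_self_le_rpow_one_add (s := a / b - 1)
    (by have := div_nonneg ha h0.le; linarith) (p := 1 + β) (by linarith)
  have e : 1 + (a / b - 1) = a / b := by ring
  rw [e, Real.div_rpow ha h0.le, Real.rpow_add' ha (by linarith), Real.rpow_add h0] at h1
  simp only [Real.rpow_one] at h1
  have hB : 0 < b ^ β := Real.rpow_pos_of_pos h0 _
  have hA : 0 ≤ a ^ β := Real.rpow_nonneg ha _
  rw [le_div_iff₀ (by positivity)] at h1
  have e2 : (1 + (1 + β) * (a / b - 1)) * (b * b ^ β) = b * b ^ β + (1 + β) * b ^ β * (a - b) := by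
    field_simp
  nlinarith [mul_le_mul_of_nonneg_right hab hA]

lemma F_lip {E : Type*} [NormedAddCommGroup E] [InnerProductSpace ℝ E] (β : ℝ) (hβ : 0 < β)
    (x y : E) (T : ℝ) (hx : ‖x‖ ≤ T) (hy : ‖y‖ ≤ T) :
    ‖‖x‖ ^ β • x - ‖y‖ ^ β • y‖ ≤ (2 + β) * T ^ β * ‖x - y‖ := by
  wlog h : ‖x‖ ≤ ‖y‖ generalizing x y
  · rw [norm_sub_rev, norm_sub_rev x]; exact this y x hy hx (le_of_not_ge h)
  have e : ‖x‖ ^ β • x - ‖y‖ ^ β • y = ‖x‖ ^ β • (x - y) - (‖y‖ ^ β - ‖x‖ ^ β) • y := by module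
  have hb : ‖x‖ ^ β ≤ ‖y‖ ^ β := Real.rpow_le_rpow (norm_nonneg _) h hβ.le
  have hT : ‖y‖ ^ β ≤ T ^ β := Real.rpow_le_rpow (norm_nonneg _) hy hβ.le
  have hb0 : 0 ≤ ‖x‖ ^ β := Real.rpow_nonneg (norm_nonneg _) _
  have hd := pow_diff β ‖x‖ ‖y‖ hβ (norm_nonneg _) h
  have ht : ‖y‖ - ‖x‖ ≤ ‖x - y‖ := by rw [norm_sub_rev]; exact norm_sub_norm_le _ _
  rw [e]
  refine (norm_sub_le _ _).trans ?_
  rw [norm_smul, norm_smul, Real.norm_of_nonneg hb0, Real.norm_of_nonneg (by linarith)]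
  have h4 : (1 + β) * ‖y‖ ^ β * (‖y‖ - ‖x‖) ≤ (1 + β) * T ^ β * ‖x - y‖ := by
    have : 0 ≤ ‖y‖ - ‖x‖ := by linarith
    have : 0 ≤ T ^ β := by linarith
    gcongr
  have h5 : ‖x‖ ^ β * ‖x - y‖ ≤ T ^ β * ‖x - y‖ := by gcongr
  linarith

/-- The integer vector as a Euclidean vector. -/
def emb {d : ℕ} (k : Fin d → ℤ) : EuclideanSpace ℝ (Fin d) := WithLp.toLp 2 (fun i => (k i : ℝ))

lemma emb_norm {d : ℕ} (k : Fin d → ℤ) : ‖emb k‖ = Real.sqrt (∑ j, ((k j : ℝ))^2) := by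
  rw [EuclideanSpace.norm_eq]; simp [emb]

lemma jbr_eq {d : ℕ} (k : Fin d → ℤ) : jbr k = Real.sqrt (1 + ‖emb k‖ ^ 2) := by
  rw [emb_norm, Real.sq_sqrt (Finset.sum_nonneg fun _ _ => sq_nonneg _), jbr, Real.sqrt_eq_rpow]

lemma center_eq (α : ℝ) {d : ℕ} (k : Fin d → ℤ) (i : Fin d) :
    alphaCenter α k i = (‖emb k‖ ^ (α/(1-α)) • emb k) i := by
  rw [emb_norm]; simp [alphaCenter, emb]

lemma sqrt_one_le (t : ℝ) : 1 ≤ Real.sqrt (1 + t ^ 2) :=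
  Real.one_le_sqrt.2 (by nlinarith [sq_nonneg t])

lemma le_sqrt_one (t : ℝ) : t ≤ Real.sqrt (1 + t ^ 2) :=
  Real.le_sqrt_of_sq_le (by linarith)

lemma sqrt_le_add (t : ℝ) (ht : 0 ≤ t) : Real.sqrt (1 + t ^ 2) ≤ 1 + t :=
  Real.sqrt_le_iff.2 ⟨by linarith, by nlinarith⟩

lemma norm_le_of_coord {d : ℕ} (x : EuclideanSpace ℝ (Fin d)) (T : ℝ) (hT : 0 ≤ T)
    (h : ∀ i, |x i| ≤ T) : ‖x‖ ≤ Real.sqrt d * T := by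
  rw [EuclideanSpace.norm_eq]
  refine Real.sqrt_le_iff.2 ⟨by positivity, ?_⟩
  rw [mul_pow, Real.sq_sqrt (Nat.cast_nonneg _)]
  calc ∑ i, ‖x i‖ ^ 2 ≤ ∑ i : Fin d, T ^ 2 :=
        Finset.sum_le_sum fun i _ => by
          rw [Real.norm_eq_abs]; exact pow_le_pow_left₀ (abs_nonneg _) (h i) 2
    _ = d * T ^ 2 := by simp

lemma cube_norm (α : ℝ) {d : ℕ} (k : Fin d → ℤ) (r : ℝ) (hr : 0 < r)
    (ξ : EuclideanSpace ℝ (Fin d)) (h : ξ ∈ alphaCube α k r) :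
    ‖ξ - ‖emb k‖ ^ (α/(1-α)) • emb k‖ ≤ Real.sqrt d * r * jbr k ^ (α/(1-α)) := by
  rw [mul_assoc]
  have hj : 1 ≤ jbr k := by rw [jbr_eq]; exact sqrt_one_le _
  refine norm_le_of_coord _ _ (by positivity) fun i => ?_
  have := h i
  rw [center_eq] at this
  simpa using this

lemma mem_cube (α : ℝ) {d : ℕ} (k : Fin d → ℤ) (r : ℝ)
    (ξ : EuclideanSpace ℝ (Fin d))
    (h : ‖ξ - ‖emb k‖ ^ (α/(1-α)) • emb k‖ ≤ r * jbr k ^ (α/(1-α))) : ξ ∈ alphaCube α k r := by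
  intro i
  rw [center_eq]
  refine le_trans ?_ h
  have := PiLp.norm_apply_le (ξ - ‖emb k‖ ^ (α/(1-α)) • emb k) i
  simpa using this

lemma cube_volume (α : ℝ) {d : ℕ} (k : Fin d → ℤ) (r : ℝ) (hr : 0 < r) :
    volume (alphaCube α k r) = ENNReal.ofReal ((2 * r * jbr k ^ (α/(1-α))) ^ d) := by
  have hj : 1 ≤ jbr k := by rw [jbr_eq]; exact sqrt_one_le _
  have e : alphaCube α k r = WithLp.ofLp ⁻¹' (Set.Icc
      (fun i => alphaCenter α k i - r * jbr k ^ (α/(1-α)))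
      (fun i => alphaCenter α k i + r * jbr k ^ (α/(1-α)))) := by
    ext ξ
    simp only [alphaCube, Set.mem_setOf_eq, Set.mem_preimage, Set.mem_Icc, Pi.le_def,
      ← forall_and, abs_le]
    refine forall_congr' fun i => ⟨fun h => ⟨?_, ?_⟩, fun h => ⟨?_, ?_⟩⟩ <;> linarith [h.1, h.2]
  rw [e, (PiLp.volume_preserving_ofLp (Fin d)).measure_preimage
    measurableSet_Icc.nullMeasurableSet, Real.volume_Icc_pi]
  have : ∀ i : Fin d, (alphaCenter α k i + r * jbr k ^ (α/(1-α)))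
      - (alphaCenter α k i - r * jbr k ^ (α/(1-α))) = 2 * r * jbr k ^ (α/(1-α)) := by
    intro i; ring
  simp only [this, Finset.prod_const, Finset.card_univ, Fintype.card_fin]
  rw [ENNReal.ofReal_pow (by positivity)]

lemma cover (n : ℕ) (α : ℝ) (hα0 : 0 < α) (hα1 : α < 1) (r : ℝ)
    (hr : (2 + α/(1-α)) * (1 + Real.sqrt n) ^ (α/(1-α)) * Real.sqrt n ≤ r)
    (ξ : EuclideanSpace ℝ (Fin n)) : ∃ k : Fin n → ℤ, ξ ∈ alphaCube α k r := by
  have h1α : 0 < 1 - α := by linarith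
  have hβ : 0 < α/(1-α) := div_pos hα0 h1α
  obtain ⟨η, hη⟩ : ∃ η : EuclideanSpace ℝ (Fin n), ‖η‖ ^ (α/(1-α)) • η = ξ := by
    refine ⟨‖ξ‖ ^ (-α) • ξ, ?_⟩
    rcases (norm_nonneg ξ).eq_or_lt with h0 | h0
    · rw [norm_eq_zero.1 h0.symm]; simp
    have hn : ‖‖ξ‖ ^ (-α) • ξ‖ = ‖ξ‖ ^ (1 - α) := by
      rw [norm_smul, Real.norm_of_nonneg (by positivity), sub_eq_neg_add, Real.rpow_add h0,
        Real.rpow_one]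
    rw [hn, ← Real.rpow_mul h0.le, smul_smul, ← Real.rpow_add h0]
    have : (1 - α) * (α / (1 - α)) + -α = 0 := by field_simp; ring
    rw [this]; simp
  refine ⟨fun i => round (η i), ?_⟩
  set k : Fin n → ℤ := fun i => round (η i) with hk
  have hd : ‖η - emb k‖ ≤ Real.sqrt n := by
    have := norm_le_of_coord (η - emb k) (1/2) (by norm_num) (fun i => by
      simpa [emb, hk] using abs_sub_round (η i))
    nlinarith [Real.sqrt_nonneg (n : ℝ)]
  have hj : 1 ≤ jbr k := by rw [jbr_eq]; exact sqrt_one_le _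
  have hkj : ‖emb k‖ ≤ jbr k := by rw [jbr_eq]; exact le_sqrt_one _
  have hs := Real.sqrt_nonneg (n : ℝ)
  have hηj : ‖η‖ ≤ (1 + Real.sqrt n) * jbr k := by
    have := norm_le_norm_add_norm_sub' η (emb k)
    nlinarith
  apply mem_cube
  rw [← hη]
  refine (F_lip _ hβ η (emb k) _ hηj (by nlinarith)).trans ?_
  rw [Real.mul_rpow (by positivity) (by positivity)]
  have hJ : 0 ≤ jbr k ^ (α/(1-α)) := by positivity
  calc _ ≤ (2 + α / (1 - α)) * ((1 + √↑n) ^ (α / (1 - α)) * jbr k ^ (α / (1 - α))) * Real.sqrt n := by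
        gcongr
    _ = ((2 + α/(1-α)) * (1 + Real.sqrt n) ^ (α/(1-α)) * Real.sqrt n) * jbr k ^ (α/(1-α)) := by ring
    _ ≤ _ := by gcongr

lemma one_le_emb {n : ℕ} (k : Fin n → ℤ) (h : emb k ≠ 0) : 1 ≤ ‖emb k‖ := by
  obtain ⟨i, hi⟩ : ∃ i, k i ≠ 0 := by
    by_contra! hc
    apply h
    ext i
    simp [emb, hc i]
  have h1 : (1 : ℝ) ≤ |(k i : ℝ)| := by exact_mod_cast Int.one_le_abs hi
  have h2 := PiLp.norm_apply_le (emb k) i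
  exact h1.trans (by simpa [emb] using h2)

lemma overlap_dist (n : ℕ) (α : ℝ) (hα0 : 0 < α) (hα1 : α < 1) (r : ℝ) (hr : 0 < r)
    (ξ : EuclideanSpace ℝ (Fin n)) (k l : Fin n → ℤ) (hk : ξ ∈ alphaCube α k r)
    (hl : ξ ∈ alphaCube α l r) :
    ‖emb k - emb l‖ ≤ 4 * (Real.sqrt n * r) * 2 ^ (α/(1-α)) := by
  wlog h : ‖emb l‖ ≤ ‖emb k‖ generalizing k l
  · rw [norm_sub_rev]; exact this l k hl hk (le_of_not_ge h)
  have h1α : 0 < 1 - α := by linarith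
  have hβ : 0 < α/(1-α) := div_pos hα0 h1α
  by_cases h0 : emb k = 0
  · have : emb l = 0 := by rw [h0, norm_zero] at h; exact norm_le_zero_iff.1 h
    rw [h0, this]; simp; positivity
  have hk1 := one_le_emb k h0
  have hj : 1 ≤ jbr k := by rw [jbr_eq]; exact sqrt_one_le _
  have hjl : 1 ≤ jbr l := by rw [jbr_eq]; exact sqrt_one_le _
  have hlk : jbr l ≤ jbr k := by rw [jbr_eq, jbr_eq]; gcongr
  have hj2 : jbr k ≤ 2 * ‖emb k‖ := by
    rw [jbr_eq]; linarith [sqrt_le_add ‖emb k‖ (norm_nonneg _)]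
  have h1 := F_mono _ hβ (emb k) (emb l) h
  have h2 := cube_norm α k r hr ξ hk
  have h3 := cube_norm α l r hr ξ hl
  have h4 : ‖‖emb k‖ ^ (α/(1-α)) • emb k - ‖emb l‖ ^ (α/(1-α)) • emb l‖ ≤
      ‖ξ - ‖emb k‖ ^ (α/(1-α)) • emb k‖ + ‖ξ - ‖emb l‖ ^ (α/(1-α)) • emb l‖ := by
    rw [add_comm]
    refine le_trans (le_of_eq ?_) (norm_sub_le _ _)
    congr 1; abel
  have h5 : jbr l ^ (α/(1-α)) ≤ jbr k ^ (α/(1-α)) := Real.rpow_le_rpow (by linarith) hlk hβ.le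
  have h6 : jbr k ^ (α/(1-α)) ≤ 2 ^ (α/(1-α)) * ‖emb k‖ ^ (α/(1-α)) := by
    rw [← Real.mul_rpow (by norm_num) (norm_nonneg _)]
    exact Real.rpow_le_rpow (by linarith) hj2 hβ.le
  have hs : 0 ≤ Real.sqrt n * r := by positivity
  have h7 := mul_le_mul_of_nonneg_left h5 hs
  have h8 := mul_le_mul_of_nonneg_left h6 hs
  have hp : 0 < ‖emb k‖ ^ (α/(1-α)) := Real.rpow_pos_of_pos (by linarith) _
  refine le_of_mul_le_mul_left ?_ hp
  linarith

lemma overlap (n : ℕ) (α : ℝ) (hα0 : 0 < α) (hα1 : α < 1) (r : ℝ) (hr : 0 < r) :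
    ∃ n₀ : ℕ, ∀ ξ : EuclideanSpace ℝ (Fin n),
      {k : Fin n → ℤ | ξ ∈ alphaCube α k r}.encard ≤ n₀ := by
  obtain ⟨M, hM⟩ := exists_nat_ge (4 * (Real.sqrt n * r) * 2 ^ (α/(1-α)))
  refine ⟨(2 * M + 1) ^ n, fun ξ => ?_⟩
  rcases Set.eq_empty_or_nonempty {k : Fin n → ℤ | ξ ∈ alphaCube α k r} with he | ⟨l, hl⟩
  · rw [he]; simp
  have hsub : {k : Fin n → ℤ | ξ ∈ alphaCube α k r} ⊆
      ((Finset.Icc (fun i => l i - M) (fun i => l i + M) : Finset (Fin n → ℤ)) : Set _) := by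
    intro k hk
    have h1 := (overlap_dist n α hα0 hα1 r hr ξ k l hk hl).trans hM
    have h2 : ∀ i, |k i - l i| ≤ (M : ℤ) := by
      intro i
      have h3 := (PiLp.norm_apply_le (emb k - emb l) i).trans h1
      have h4 : |(k i : ℝ) - l i| ≤ M := by simpa [emb] using h3
      exact_mod_cast h4
    simp only [Finset.coe_Icc, Set.mem_Icc, Pi.le_def]
    exact ⟨fun i => by have := abs_le.1 (h2 i); linarith [this.1],
      fun i => by have := abs_le.1 (h2 i); linarith [this.2]⟩
  refine (Set.encard_le_encard hsub).trans ?_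
  rw [Set.encard_coe_eq_coe_finsetCard, Pi.card_Icc]
  have : ∀ i : Fin n, (Finset.Icc (l i - (M:ℤ)) (l i + M)).card = 2 * M + 1 := by
    intro i; rw [Int.card_Icc]; omega
  simp [this]

lemma compar (n : ℕ) (α : ℝ) (hα0 : 0 < α) (hα1 : α < 1) (r : ℝ) (hr : 0 < r) :
    ∃ c C : ℝ, 0 < c ∧ c ≤ C ∧
      ∀ (k : Fin n → ℤ) (ξ : EuclideanSpace ℝ (Fin n)), ξ ∈ alphaCube α k r →
        c * Real.sqrt (1 + ‖ξ‖^2) ≤ jbr k ^ ((1:ℝ)/(1-α)) ∧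
        jbr k ^ ((1:ℝ)/(1-α)) ≤ C * Real.sqrt (1 + ‖ξ‖^2) := by
  have h1α : 0 < 1 - α := by linarith
  have hβ : 0 < α/(1-α) := div_pos hα0 h1α
  have e : (1:ℝ)/(1-α) = 1 + α/(1-α) := by field_simp; ring
  rw [e]
  have hcn := fun k ξ => cube_norm α (d := n) k r hr ξ
  set β := α/(1-α)
  set s := Real.sqrt n * r
  have hs : 0 ≤ s := by positivity
  set A : ℝ := 2 ^ (1 + β)
  have hA : 1 ≤ A := Real.one_le_rpow (by norm_num) (by linarith)
  have hP : 0 ≤ (2 * A * s) ^ (1 + β) := by positivity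
  refine ⟨1 / (2 + s), (2 * A * s) ^ (1 + β) + 4 * A, by positivity, ?_, ?_⟩
  · have : 1 / (2 + s) ≤ 1 := by rw [div_le_one (by positivity)]; linarith
    linarith
  intro k ξ hξ
  have h := hcn k ξ hξ
  have hj : 1 ≤ jbr k := by rw [jbr_eq]; exact sqrt_one_le _
  have hkj : ‖emb k‖ ≤ jbr k := by rw [jbr_eq]; exact le_sqrt_one _
  have hjk : jbr k ≤ 1 + ‖emb k‖ := by rw [jbr_eq]; exact sqrt_le_add _ (norm_nonneg _)
  have hx1 := sqrt_one_le ‖ξ‖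
  have hx2 := le_sqrt_one ‖ξ‖
  have hx3 := sqrt_le_add ‖ξ‖ (norm_nonneg _)
  have hF : ‖‖emb k‖ ^ β • emb k‖ = ‖emb k‖ ^ (1 + β) := by
    rw [norm_smul, Real.norm_of_nonneg (by positivity), Real.rpow_add' (norm_nonneg _) (by linarith),
      Real.rpow_one, mul_comm]
  have hJ : jbr k ^ (1 + β) = jbr k * jbr k ^ β := by
    rw [Real.rpow_add (by linarith), Real.rpow_one]
  have hJ1 : 1 ≤ jbr k ^ β := Real.one_le_rpow hj hβ.le
  have hJ2 : 1 ≤ jbr k ^ (1 + β) := Real.one_le_rpow hj (by linarith)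
  have hJ3 : jbr k ^ β ≤ jbr k ^ (1 + β) := by rw [hJ]; nlinarith
  have hE : ‖emb k‖ ^ (1 + β) ≤ jbr k ^ (1 + β) :=
    Real.rpow_le_rpow (norm_nonneg _) hkj (by linarith)
  constructor
  · have := norm_le_norm_add_norm_sub' ξ (‖emb k‖ ^ β • emb k)
    rw [hF] at this
    rw [one_div, inv_mul_le_iff₀ (by positivity)]
    nlinarith [mul_le_mul_of_nonneg_left hJ3 hs]
  · have h1 := norm_le_norm_add_norm_sub (‖emb k‖ ^ β • emb k) ξ
    have h1' : ‖emb k‖ ^ (1 + β) ≤ ‖ξ‖ + s * jbr k ^ β := by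
      have := norm_sub_norm_le (‖emb k‖ ^ β • emb k) ξ
      rw [norm_sub_rev, hF] at this
      linarith
    have h2 : jbr k ^ (1 + β) ≤ A * (1 + ‖emb k‖ ^ (1 + β)) := by
      have hE0 : 0 ≤ ‖emb k‖ ^ (1 + β) := by positivity
      rcases le_total ‖emb k‖ 1 with hc | hc
      · have : jbr k ^ (1 + β) ≤ A := Real.rpow_le_rpow (by linarith) (by linarith) (by linarith)
        nlinarith
      · have : jbr k ^ (1 + β) ≤ (2 * ‖emb k‖) ^ (1 + β) :=
          Real.rpow_le_rpow (by linarith) (by linarith) (by linarith)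
        rw [Real.mul_rpow (by norm_num) (norm_nonneg _)] at this
        change _ ≤ A * _ at this
        linarith
    rcases le_total (jbr k) (2 * A * s) with hc | hc
    · have : jbr k ^ (1 + β) ≤ (2 * A * s) ^ (1 + β) :=
        Real.rpow_le_rpow (by linarith) hc (by linarith)
      nlinarith
    · have h3 : 2 * A * s * jbr k ^ β ≤ jbr k ^ (1 + β) := by
        rw [hJ]; gcongr
      have h4 := mul_le_mul_of_nonneg_left h1' (show 0 ≤ A by linarith)
      have h5 : jbr k ^ (1 + β) ≤ 2 * A * (1 + ‖ξ‖) := by linarith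
      nlinarith

/-- Let `n ≥ 1` and `0 < α < 1`. There exists `r₁ > 0` such that for every
`r > r₁`: (i) the cubes `Q_k(r)`, `k ∈ ℤⁿ`, cover `ℝⁿ`; (ii) each point belongs to at most
`n₀` of the cubes; (iii) `⟨k⟩^{1/(1-α)} ≍ ⟨ξ⟩` uniformly for `ξ ∈ Q_k(r)`, so that
`|Q_k(r)| ≍ ⟨ξ⟩^{nα}` uniformly for `ξ ∈ Q_k(r)`. -/
theorem alpha_covering_exists
    (n : ℕ) (hn : 1 ≤ n) (α : ℝ) (hα0 : 0 < α) (hα1 : α < 1) :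
    ∃ r₁ : ℝ, 0 < r₁ ∧ ∀ r : ℝ, r₁ < r →
      (∀ ξ : EuclideanSpace ℝ (Fin n), ∃ k : Fin n → ℤ, ξ ∈ alphaCube α k r) ∧
      (∃ n₀ : ℕ, ∀ ξ : EuclideanSpace ℝ (Fin n),
          {k : Fin n → ℤ | ξ ∈ alphaCube α k r}.encard ≤ n₀) ∧
      (∃ c C : ℝ, 0 < c ∧ c ≤ C ∧
          ∀ (k : Fin n → ℤ) (ξ : EuclideanSpace ℝ (Fin n)), ξ ∈ alphaCube α k r →
            c * Real.sqrt (1 + ‖ξ‖^2) ≤ jbr k ^ ((1:ℝ)/(1-α)) ∧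
            jbr k ^ ((1:ℝ)/(1-α)) ≤ C * Real.sqrt (1 + ‖ξ‖^2)) ∧
      (∃ c' C' : ℝ, 0 < c' ∧ c' ≤ C' ∧
          ∀ (k : Fin n → ℤ) (ξ : EuclideanSpace ℝ (Fin n)), ξ ∈ alphaCube α k r →
            ENNReal.ofReal (c' * Real.sqrt (1 + ‖ξ‖^2) ^ ((n:ℝ)*α)) ≤
              volume (alphaCube α k r) ∧
            volume (alphaCube α k r) ≤
              ENNReal.ofReal (C' * Real.sqrt (1 + ‖ξ‖^2) ^ ((n:ℝ)*α))) := by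
  have h1α : 0 < 1 - α := by linarith
  have hβ : 0 < α/(1-α) := div_pos hα0 h1α
  have hn0 : (0 : ℝ) < n := by exact_mod_cast hn
  have hr1 : 0 < (2 + α/(1-α)) * (1 + Real.sqrt n) ^ (α/(1-α)) * Real.sqrt n := by positivity
  refine ⟨_, hr1, fun r hr => ?_⟩
  have hr0 : 0 < r := hr1.trans hr
  refine ⟨fun ξ => cover n α hα0 hα1 r hr.le ξ, overlap n α hα0 hα1 r hr0,
    compar n α hα0 hα1 r hr0, ?_⟩
  obtain ⟨c, C, hc, hcC, h⟩ := compar n α hα0 hα1 r hr0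
  have hC : 0 < C := hc.trans_le hcC
  refine ⟨(2 * r) ^ n * c ^ ((n:ℝ) * α), (2 * r) ^ n * C ^ ((n:ℝ) * α), by positivity,
    by gcongr, fun k ξ hξ => ?_⟩
  obtain ⟨h1, h2⟩ := h k ξ hξ
  have hj : 1 ≤ jbr k := by rw [jbr_eq]; exact sqrt_one_le _
  have hx := sqrt_one_le ‖ξ‖
  have e : (2 * r * jbr k ^ (α/(1-α))) ^ n
      = (2 * r) ^ n * (jbr k ^ ((1:ℝ)/(1-α))) ^ ((n:ℝ) * α) := by
    rw [mul_pow, ← Real.rpow_mul (by linarith), ← Real.rpow_natCast (jbr k ^ _),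
      ← Real.rpow_mul (by linarith)]
    congr 2
    field_simp
  rw [cube_volume α k r hr0, e]
  have hna : 0 ≤ (n:ℝ) * α := by positivity
  constructor
  · apply ENNReal.ofReal_le_ofReal
    rw [mul_assoc, ← Real.mul_rpow hc.le (by linarith)]
    gcongr
  · apply ENNReal.ofReal_le_ofReal
    rw [mul_assoc, ← Real.mul_rpow hC.le (by linarith)]
    gcongr
end
end

section
/- Let n ≥ 2 and 1 ≤ p ≤ ∞. There exist N ∈ ℕ and C > 0 such that for every Schwartz function f ∈ 𝒮(ℝⁿ) and every k̄ ∈ ℤ^{n−1}, ‖□_{k̄}(Tr f)‖_{L^p(ℝ^{n−1})} ≤ C Σ_{l∈ℤⁿ, |l̄ − k̄|_∞ ≤ N} ‖□_l f‖_{L^p(ℝⁿ)}, where l̄ = (l_1,…,l_{n−1}) and the sum runs over all l_n ∈ ℤ. -/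
open MeasureTheory FourierTransform
open scoped ENNReal NNReal

noncomputable section

/-- `η` is an admissible bump function: smooth, valued in `[0,1]`, equal to `1` on `|t| ≤ 1`
and vanishing for `|t| ≥ 2`. -/
def IsBump (η : ℝ → ℝ) : Prop :=
  ContDiff ℝ (⊤ : ℕ∞) η ∧ (∀ t, η t ∈ Set.Icc (0:ℝ) 1) ∧ (∀ t, |t| ≤ 1 → η t = 1) ∧
    (∀ t, 2 ≤ |t| → η t = 0)

/-- `ψ_k`, the normalized window at frequency `k ∈ ℤ^d`. -/
def unifWindow (η : ℝ → ℝ) {d : ℕ} (k : Fin d → ℤ) (ξ : EuclideanSpace ℝ (Fin d)) : ℝ :=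
  (∏ i, η (2 * (ξ i - k i))) / ∑' l : Fin d → ℤ, ∏ i, η (2 * (ξ i - l i))

/-- The frequency-uniform decomposition operator `□_k f = 𝓕⁻¹(ψ_k 𝓕 f)`. -/
def unifBox (η : ℝ → ℝ) {d : ℕ} (k : Fin d → ℤ) (f : EuclideanSpace ℝ (Fin d) → ℂ) :
    EuclideanSpace ℝ (Fin d) → ℂ :=
  𝓕⁻ (fun ξ => (unifWindow η k ξ : ℂ) * 𝓕 f ξ)

/-- The `ℓ^q` combination of a family of extended nonnegative reals, with the supremum
modification for `q = ∞`. -/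
def lqSum {ι : Type*} (q : ℝ≥0∞) (a : ι → ℝ≥0∞) : ℝ≥0∞ :=
  if q = ∞ then ⨆ i, a i else (∑' i, a i ^ q.toReal) ^ (1 / q.toReal)

/-- The modulation space quasi-norm `‖f‖_{M^s_{p,q}(ℝ^d)}`. -/
def modNorm (η : ℝ → ℝ) {d : ℕ} (s : ℝ) (p q : ℝ≥0∞) (f : EuclideanSpace ℝ (Fin d) → ℂ) :
    ℝ≥0∞ :=
  lqSum q (fun k : Fin d → ℤ =>
    ENNReal.ofReal (jbr k ^ s) * eLpNorm (unifBox η k f) p volume)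

/-- The anisotropic modulation space quasi-norm `‖f‖_{M^s_{p,q,r}(ℝ^{m+1})}`. -/
def modNormAniso (η : ℝ → ℝ) {m : ℕ} (s : ℝ) (p q r : ℝ≥0∞)
    (f : EuclideanSpace ℝ (Fin (m+1)) → ℂ) : ℝ≥0∞ :=
  lqSum r (fun kn : ℤ => lqSum q (fun kb : Fin m → ℤ =>
    ENNReal.ofReal (jbr kb ^ s) *
      eLpNorm (unifBox η (Fin.snoc kb kn) f) p volume))

/-- The trace `(Tr f)(x̄) = f(x̄, 0)` on the hyperplane `x_n = 0`. -/
def traceFn {m : ℕ} (f : EuclideanSpace ℝ (Fin (m+1)) → ℂ)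
    (x : EuclideanSpace ℝ (Fin m)) : ℂ :=
  f ((WithLp.equiv 2 (Fin (m+1) → ℝ)).symm
      (Fin.snoc ((WithLp.equiv 2 (Fin m → ℝ)) x) 0))


lemma eLpNorm_tsum_le_aux {α ι : Type*} [Countable ι] [MeasurableSpace α] {μ : Measure α}
    (v : ι → α → ℝ≥0∞) (hv : ∀ i, Measurable (v i)) {p : ℝ≥0∞} (hp : 1 ≤ p) :
    eLpNorm (fun x => ∑' i, v i x) p μ ≤ ∑' i, eLpNorm (v i) p μ := by
  have hp0 : p ≠ 0 := by rintro rfl; simp at hp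
  by_cases hpt : p = ∞
  · subst hpt
    simp only [eLpNorm_exponent_top]
    refine eLpNormEssSup_le_of_ae_enorm_bound ?_
    have : ∀ᵐ x ∂μ, ∀ i, ‖v i x‖ₑ ≤ eLpNormEssSup (v i) μ :=
      ae_all_iff.2 fun i => enorm_ae_le_eLpNormEssSup _ _
    filter_upwards [this] with x hx
    simp only [enorm_eq_self] at hx ⊢
    exact ENNReal.tsum_le_tsum hx
  · have hr : 0 < p.toReal := ENNReal.toReal_pos hp0 hpt
    have key : ∀ s : Finset ι, eLpNorm (fun x => ∑ i ∈ s, v i x) p μ ≤ ∑' i, eLpNorm (v i) p μ := by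
      intro s
      refine le_trans ?_ (ENNReal.sum_le_tsum s)
      classical
      induction s using Finset.induction_on with
      | empty => simp
      | insert a s ha ih =>
        simp only [Finset.sum_insert ha]
        refine le_trans (eLpNorm_add_le (hv a).aestronglyMeasurable
          (Finset.measurable_fun_sum s fun i _ => hv i).aestronglyMeasurable hp) ?_
        gcongr
    rw [eLpNorm_eq_lintegral_rpow_enorm_toReal hp0 hpt]
    rw [one_div, ENNReal.rpow_inv_le_iff hr]
    simp only [enorm_eq_self, ENNReal.tsum_eq_iSup_sum]
    have : ∀ x, (⨆ s : Finset ι, ∑ i ∈ s, v i x) ^ p.toReal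
        = ⨆ s : Finset ι, (∑ i ∈ s, v i x) ^ p.toReal := fun x =>
      (ENNReal.monotone_rpow_of_nonneg hr.le).map_iSup_of_continuousAt
        (ENNReal.continuous_rpow_const.continuousAt) (by simp [hr])
    simp only [this]
    rw [lintegral_iSup_directed]
    · refine iSup_le fun s => ?_
      have := key s
      rw [eLpNorm_eq_lintegral_rpow_enorm_toReal hp0 hpt, one_div, ENNReal.rpow_inv_le_iff hr] at this
      simpa only [enorm_eq_self, ENNReal.tsum_eq_iSup_sum] using this
    · intro s
      exact ((Finset.measurable_fun_sum s fun i _ => hv i).pow_const _).aemeasurable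
    · intro s t
      classical
      refine ⟨s ∪ t, fun x => ?_, fun x => ?_⟩ <;> dsimp only <;> gcongr
      · exact Finset.subset_union_left
      · exact Finset.subset_union_right

lemma schur_aux {X Y : Type*} [MeasurableSpace X] [MeasurableSpace Y] {μ : Measure X} {ν : Measure Y}
    [SFinite μ] [SFinite ν] (K : X → Y → ℝ≥0∞) (hK : Measurable (Function.uncurry K))
    (g : Y → ℝ≥0∞) (hg : Measurable g) {p : ℝ≥0∞} (hp : 1 ≤ p) (A : ℝ≥0∞) (hA : A ≠ ∞)
    (h1 : ∀ x, ∫⁻ y, K x y ∂ν ≤ A) (h2 : ∀ y, ∫⁻ x, K x y ∂μ ≤ A) :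
    eLpNorm (fun x => ∫⁻ y, K x y * g y ∂ν) p μ ≤ A * eLpNorm g p ν := by
  have hp0 : p ≠ 0 := by rintro rfl; simp at hp
  have hKx : ∀ x, Measurable (K x) := fun x => hK.comp measurable_prodMk_left
  by_cases hpt : p = ∞
  · subst hpt
    simp only [eLpNorm_exponent_top]
    refine eLpNormEssSup_le_of_ae_enorm_bound (Filter.Eventually.of_forall fun x => ?_)
    rw [enorm_eq_self]
    calc ∫⁻ y, K x y * g y ∂ν ≤ ∫⁻ y, K x y * eLpNormEssSup g ν ∂ν := by
          refine lintegral_mono_ae ?_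
          filter_upwards [enorm_ae_le_eLpNormEssSup g ν] with y hy
          rw [enorm_eq_self] at hy
          gcongr
      _ = (∫⁻ y, K x y ∂ν) * eLpNormEssSup g ν := lintegral_mul_const _ (hKx x)
      _ ≤ _ := by gcongr; exact h1 x
  · have hr : 0 < p.toReal := ENNReal.toReal_pos hp0 hpt
    have hr1 : 1 ≤ p.toReal := by
      rw [← ENNReal.toReal_one]; exact ENNReal.toReal_mono hpt hp
    set r := p.toReal with hrdef
    have hpw : ∀ x, (∫⁻ y, K x y * g y ∂ν) ^ r ≤ A ^ (r - 1) * ∫⁻ y, K x y * g y ^ r ∂ν := by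
      intro x
      have := eLpNorm_le_eLpNorm_mul_rpow_measure_univ (μ := ν.withDensity (K x)) (f := g) hp
        hg.aestronglyMeasurable
      rw [eLpNorm_one_eq_lintegral_enorm, eLpNorm_eq_lintegral_rpow_enorm_toReal hp0 hpt] at this
      simp only [enorm_eq_self] at this
      rw [lintegral_withDensity_eq_lintegral_mul _ (hKx x) hg,
        lintegral_withDensity_eq_lintegral_mul _ (hKx x) (hg.pow_const _),
        withDensity_apply _ MeasurableSet.univ, Measure.restrict_univ] at this
      simp only [Pi.mul_apply] at this
      rw [← hrdef] at this
      have h3 := ENNReal.rpow_le_rpow this hr.le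
      refine h3.trans ?_
      rw [ENNReal.mul_rpow_of_nonneg _ _ hr.le, ← ENNReal.rpow_mul, ← ENNReal.rpow_mul, mul_comm]
      have e1 : 1 / r * r = 1 := by field_simp
      have e2 : (1 / (1:ℝ≥0∞).toReal - 1 / r) * r = r - 1 := by
        simp; field_simp
      rw [e1, e2, ENNReal.rpow_one]
      gcongr
      · exact h1 x
    rw [eLpNorm_eq_lintegral_rpow_enorm_toReal hp0 hpt, ← hrdef, one_div, ENNReal.rpow_inv_le_iff hr,
      eLpNorm_eq_lintegral_rpow_enorm_toReal hp0 hpt, ← hrdef, ENNReal.mul_rpow_of_nonneg _ _ hr.le,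
      ← ENNReal.rpow_mul, one_div, inv_mul_cancel₀ hr.ne', ENNReal.rpow_one]
    simp only [enorm_eq_self]
    calc ∫⁻ x, (∫⁻ y, K x y * g y ∂ν) ^ r ∂μ ≤ ∫⁻ x, A ^ (r - 1) * ∫⁻ y, K x y * g y ^ r ∂ν ∂μ :=
          lintegral_mono hpw
      _ = A ^ (r - 1) * ∫⁻ x, ∫⁻ y, K x y * g y ^ r ∂ν ∂μ := by
          rw [lintegral_const_mul']
          exact ENNReal.rpow_ne_top_of_nonneg (by linarith) hA
      _ = A ^ (r - 1) * ∫⁻ y, ∫⁻ x, K x y * g y ^ r ∂μ ∂ν := by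
          rw [lintegral_lintegral_swap]
          exact (hK.mul ((hg.comp measurable_snd).pow_const _)).aemeasurable
      _ ≤ A ^ (r - 1) * ∫⁻ y, A * g y ^ r ∂ν := by
          gcongr with y
          rw [lintegral_mul_const _ (show Measurable (fun x => K x y) from hK.comp measurable_prodMk_right)]
          gcongr
          exact h2 y
      _ = A ^ (r-1) * A * ∫⁻ y, g y ^ r ∂ν := by
          rw [lintegral_const_mul' _ _ hA, mul_assoc]
      _ = _ := by
          congr 1
          nth_rw 2 [← ENNReal.rpow_one A]
          rw [← ENNReal.rpow_add_of_nonneg _ _ (by linarith) (by norm_num)]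
          simp

lemma contDiff_rho {η : ℝ → ℝ} (hη : IsBump η) {d : ℕ} (l : Fin d → ℤ) :
    ContDiff ℝ (⊤ : ℕ∞) (fun ξ : EuclideanSpace ℝ (Fin d) => ∏ i, η (2 * (ξ i - l i))) := by
  have h := hη.1
  refine contDiff_prod fun i _ => ?_
  fun_prop

lemma rho_ne_zero {η : ℝ → ℝ} (hη : IsBump η) {d : ℕ} (l : Fin d → ℤ)
    (ξ : EuclideanSpace ℝ (Fin d)) (h : ∏ i, η (2 * (ξ i - l i)) ≠ 0) (i : Fin d) :
    |ξ i - l i| < 1 := by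
  by_contra hc
  push Not at hc
  apply h
  refine Finset.prod_eq_zero (Finset.mem_univ i) (hη.2.2.2 _ ?_)
  rw [abs_mul, abs_two]
  linarith

lemma finite_near {d : ℕ} (ξ : EuclideanSpace ℝ (Fin d)) :
    {l : Fin d → ℤ | ∀ i, |ξ i - l i| < 2}.Finite := by
  refine (Set.Finite.pi' (t := fun i => Set.Icc (⌊ξ i⌋ - 3) (⌊ξ i⌋ + 3))
    (fun i => Set.finite_Icc _ _)).subset ?_
  intro l hl i
  have h := abs_lt.1 (hl i)
  have h1 := Int.floor_le (ξ i)
  have h2 := Int.lt_floor_add_one (ξ i)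
  constructor
  · have : ((⌊ξ i⌋ - 3 : ℤ) : ℝ) ≤ l i := by push_cast; linarith
    exact_mod_cast this
  · have : (l i : ℝ) ≤ ((⌊ξ i⌋ + 3 : ℤ) : ℝ) := by push_cast; linarith
    exact_mod_cast this

lemma rho_finite {η : ℝ → ℝ} (hη : IsBump η) {d : ℕ} (ξ : EuclideanSpace ℝ (Fin d)) :
    (Function.support fun l : Fin d → ℤ => ∏ i, η (2 * (ξ i - l i))).Finite := by
  refine (finite_near ξ).subset fun l hl i => ?_
  have := rho_ne_zero hη l ξ hl i
  linarith

lemma one_le_den {η : ℝ → ℝ} (hη : IsBump η) {d : ℕ} (ξ : EuclideanSpace ℝ (Fin d)) :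
    1 ≤ ∑' l : Fin d → ℤ, ∏ i, η (2 * (ξ i - l i)) := by
  have hs : Summable fun l : Fin d → ℤ => ∏ i, η (2 * (ξ i - l i)) :=
    summable_of_hasFiniteSupport (rho_finite hη ξ)
  have h1 : ∏ i, η (2 * (ξ i - (fun i => round (ξ i) : Fin d → ℤ) i)) = 1 := by
    refine Finset.prod_eq_one fun i _ => hη.2.2.1 _ ?_
    rw [abs_mul, abs_two]
    have := abs_sub_round (ξ i)
    linarith
  rw [← h1]
  exact hs.le_tsum (fun i => round (ξ i)) (fun l _ => Finset.prod_nonneg fun i _ => (hη.2.1 _).1)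

lemma contDiff_den {η : ℝ → ℝ} (hη : IsBump η) {d : ℕ} :
    ContDiff ℝ (⊤ : ℕ∞) (fun ξ : EuclideanSpace ℝ (Fin d) =>
      ∑' l : Fin d → ℤ, ∏ i, η (2 * (ξ i - l i))) := by
  rw [contDiff_iff_contDiffAt]
  intro ξ₀
  have h1 : ContDiff ℝ (⊤ : ℕ∞) (fun ξ : EuclideanSpace ℝ (Fin d) =>
      ∑ l ∈ (finite_near ξ₀).toFinset, ∏ i, η (2 * (ξ i - l i))) :=
    ContDiff.sum fun l _ => contDiff_rho hη l
  refine h1.contDiffAt.congr_of_eventuallyEq ?_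
  filter_upwards [Metric.ball_mem_nhds ξ₀ one_pos] with ξ hξ
  refine tsum_eq_sum fun l hl => ?_
  by_contra hne
  apply hl
  rw [Set.Finite.mem_toFinset]
  intro i
  have h2 := rho_ne_zero hη l ξ hne i
  have h3 : |ξ i - ξ₀ i| < 1 := by
    have := PiLp.norm_apply_le (ξ - ξ₀) i
    rw [Metric.mem_ball, dist_eq_norm] at hξ
    simp only [PiLp.sub_apply, Real.norm_eq_abs] at this
    linarith
  rw [abs_lt] at *
  constructor <;> linarith

lemma window_contDiff {η : ℝ → ℝ} (hη : IsBump η) {d : ℕ} (k : Fin d → ℤ) :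
    ContDiff ℝ (⊤ : ℕ∞) (unifWindow η k) :=
  (contDiff_rho hη k).div (contDiff_den hη) fun ξ => by have := one_le_den hη ξ; linarith

lemma window_ne_zero {η : ℝ → ℝ} (hη : IsBump η) {d : ℕ} (k : Fin d → ℤ)
    (ξ : EuclideanSpace ℝ (Fin d)) (h : unifWindow η k ξ ≠ 0) (i : Fin d) : |ξ i - k i| < 1 := by
  refine rho_ne_zero hη k ξ ?_ i
  intro h0
  simp [unifWindow, h0] at h

lemma window_nonneg {η : ℝ → ℝ} (hη : IsBump η) {d : ℕ} (k : Fin d → ℤ)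
    (ξ : EuclideanSpace ℝ (Fin d)) : 0 ≤ unifWindow η k ξ :=
  div_nonneg (Finset.prod_nonneg fun i _ => (hη.2.1 _).1) (by have := one_le_den hη ξ; linarith)

lemma window_hasSum {η : ℝ → ℝ} (hη : IsBump η) {d : ℕ} (ξ : EuclideanSpace ℝ (Fin d)) :
    HasSum (fun k : Fin d → ℤ => unifWindow η k ξ) 1 := by
  have hs : Summable fun l : Fin d → ℤ => ∏ i, η (2 * (ξ i - l i)) :=
    summable_of_hasFiniteSupport (rho_finite hη ξ)
  have := hs.hasSum.div_const (∑' l : Fin d → ℤ, ∏ i, η (2 * (ξ i - l i)))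
  rwa [div_self (by have := one_le_den hη ξ; linarith)] at this

/-- integer vectors as points -/
def ivec {d : ℕ} (k : Fin d → ℤ) : EuclideanSpace ℝ (Fin d) := WithLp.toLp 2 fun i => (k i : ℝ)

@[simp] lemma ivec_apply {d : ℕ} (k : Fin d → ℤ) (i : Fin d) : ivec k i = k i := rfl

lemma window_shift (η : ℝ → ℝ) {d : ℕ} (k : Fin d → ℤ) (ξ : EuclideanSpace ℝ (Fin d)) :
    unifWindow η k ξ = unifWindow η (0 : Fin d → ℤ) (ξ - ivec k) := by
  unfold unifWindow
  congr 1
  · simp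
  · rw [← (Equiv.addLeft k).tsum_eq]
    refine tsum_congr fun l => Finset.prod_congr rfl fun i _ => ?_
    congr 2
    simp
    ring

lemma hasCompactSupport_of_near {d : ℕ} {F : Type*} [Zero F] (g : EuclideanSpace ℝ (Fin d) → F)
    (c : Fin d → ℝ) (r : ℝ) (h : ∀ ξ, g ξ ≠ 0 → ∀ i, |ξ i - c i| ≤ r) : HasCompactSupport g := by
  have hK : IsCompact ((EuclideanSpace.equiv (Fin d) ℝ).symm '' 
      (Set.univ.pi fun i => Set.Icc (c i - r) (c i + r))) :=
    (isCompact_univ_pi fun i => isCompact_Icc).image (EuclideanSpace.equiv (Fin d) ℝ).symm.continuous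
  refine HasCompactSupport.intro hK fun ξ hξ => ?_
  by_contra hne
  apply hξ
  refine ⟨EuclideanSpace.equiv (Fin d) ℝ ξ, fun i _ => ?_, by simp⟩
  have := abs_le.1 (h ξ hne i)
  constructor <;> simp <;> linarith

/-- the embedding `x ↦ (x, 0)` -/
def embV {m : ℕ} (x : EuclideanSpace ℝ (Fin m)) : EuclideanSpace ℝ (Fin (m+1)) :=
  WithLp.toLp 2 (Fin.snoc (fun i => x i) 0)

/-- the projection on the first `m` coordinates -/
def projV {m : ℕ} (ξ : EuclideanSpace ℝ (Fin (m+1))) : EuclideanSpace ℝ (Fin m) :=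
  WithLp.toLp 2 fun i => ξ i.castSucc

lemma traceFn_eq {m : ℕ} (f : EuclideanSpace ℝ (Fin (m+1)) → ℂ) :
    traceFn f = fun x => f (embV x) := rfl

@[simp] lemma projV_apply {m : ℕ} (ξ : EuclideanSpace ℝ (Fin (m+1))) (i : Fin m) :
    projV ξ i = ξ i.castSucc := rfl

@[simp] lemma embV_castSucc {m : ℕ} (x : EuclideanSpace ℝ (Fin m)) (i : Fin m) :
    embV x i.castSucc = x i := by simp [embV]

@[simp] lemma embV_last {m : ℕ} (x : EuclideanSpace ℝ (Fin m)) :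
    embV x (Fin.last m) = 0 := by simp [embV]

lemma contDiff_projV {m : ℕ} : ContDiff ℝ (⊤ : ℕ∞) (projV (m := m)) := by
  rw [contDiff_euclidean]
  intro i
  simp only [projV_apply]
  fun_prop

lemma contDiff_embV {m : ℕ} : ContDiff ℝ (⊤ : ℕ∞) (embV (m := m)) := by
  rw [contDiff_euclidean]
  intro i
  refine Fin.lastCases ?_ (fun i => ?_) i
  · simp only [embV_last]
    fun_prop
  · simp only [embV_castSucc]
    fun_prop

lemma inner_embV {m : ℕ} (x : EuclideanSpace ℝ (Fin m)) (ξ : EuclideanSpace ℝ (Fin (m+1))) :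
    inner ℝ ξ (embV x) = inner ℝ (projV ξ) x := by
  simp [PiLp.inner_apply, Fin.sum_univ_castSucc]

lemma norm_projV_le {m : ℕ} (ξ : EuclideanSpace ℝ (Fin (m+1))) : ‖projV ξ‖ ≤ ‖ξ‖ := by
  rw [EuclideanSpace.norm_eq, EuclideanSpace.norm_eq]
  apply Real.sqrt_le_sqrt
  rw [Fin.sum_univ_castSucc]
  simp only [projV_apply]
  have : 0 ≤ ‖ξ (Fin.last m)‖ ^ 2 := by positivity
  linarith

lemma projV_sub_embV {m : ℕ} (y : EuclideanSpace ℝ (Fin (m+1))) (x : EuclideanSpace ℝ (Fin m)) :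
    projV (y - embV x) = projV y - x := by
  ext i; simp

section FourierAux
variable {V : Type*} [NormedAddCommGroup V] [InnerProductSpace ℝ V] [FiniteDimensional ℝ V]
  [MeasurableSpace V] [BorelSpace V]

lemma fourier_modul (a : V → ℂ) (x y : V) :
    𝓕 (fun ξ => ((Real.fourierChar (inner ℝ ξ x) : Circle) : ℂ) * a ξ) y = 𝓕 a (y - x) := by
  rw [Real.fourier_eq, Real.fourier_eq]
  refine integral_congr_ae (Filter.Eventually.of_forall fun ξ => ?_)
  simp only [Circle.smul_def, smul_eq_mul, ← mul_assoc]
  rw [inner_sub_right, neg_sub, sub_eq_neg_add, AddChar.map_add_eq_mul]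
  simp

lemma integrable_modul {a : V → ℂ} (ha : Integrable a) (x : V) :
    Integrable fun ξ => ((Real.fourierChar (inner ℝ ξ x) : Circle) : ℂ) * a ξ := by
  refine ha.bdd_mul (c := 1) ?_ ?_
  · apply Continuous.aestronglyMeasurable
    fun_prop
  · exact Filter.Eventually.of_forall fun ξ => (Circle.norm_coe _).le

lemma fourierInv_mul_fourier {a g : V → ℂ} (ha : Integrable a) (hg : Integrable g) (x : V) :
    𝓕⁻ (fun ξ => a ξ * 𝓕 g ξ) x = ∫ y, 𝓕 a (y - x) * g y := by
  have h := VectorFourier.integral_fourierIntegral_smul_eq_flip (μ := (volume : Measure V))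
    (ν := (volume : Measure V)) (L := innerₗ V) (e := Real.fourierChar)
    (Real.continuous_fourierChar) continuous_inner (integrable_modul ha x) hg
  simp only [flip_innerₗ, smul_eq_mul] at h
  rw [Real.fourierInv_eq]
  calc _ = ∫ ξ, ((Real.fourierChar (inner ℝ ξ x) : Circle) : ℂ) * a ξ * 𝓕 g ξ := by
        simp only [Circle.smul_def, smul_eq_mul, ← mul_assoc]
    _ = ∫ y, 𝓕 (fun ξ => ((Real.fourierChar (inner ℝ ξ x) : Circle) : ℂ) * a ξ) y * g y := h.symm
    _ = _ := by simp only [fourier_modul]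

lemma norm_fourier_translate (a : V → ℂ) (c y : V) :
    ‖𝓕 (fun ξ => a (ξ - c)) y‖ = ‖𝓕 a y‖ := by
  have : 𝓕 (fun ξ => a (ξ - c)) y = ((Real.fourierChar (-(inner ℝ c y)) : Circle) : ℂ) * 𝓕 a y := by
    rw [Real.fourier_eq, Real.fourier_eq, ← integral_const_mul,
      ← integral_add_right_eq_self _ c]
    refine integral_congr_ae (Filter.Eventually.of_forall fun ξ => ?_)
    simp only [Circle.smul_def, smul_eq_mul, ← mul_assoc, add_sub_cancel_right]
    rw [inner_add_left, neg_add_rev, AddChar.map_add_eq_mul]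
    simp
  rw [this, norm_mul, Circle.norm_coe, one_mul]

end FourierAux

lemma schwartz_decay {m d : ℕ} (f : SchwartzMap (EuclideanSpace ℝ (Fin d)) ℂ) :
    ∃ B : ℝ, 0 ≤ B ∧ ∀ z, ‖f z‖ ≤ B * (1 + ‖z‖) ^ (-((m:ℝ)+1)) := by
  refine ⟨2 ^ (m+1) * (Finset.Iic (m+1, 0)).sup (fun m => SchwartzMap.seminorm ℝ m.1 m.2) f,
    by positivity, fun z => ?_⟩
  have := SchwartzMap.one_add_le_sup_seminorm_apply (𝕜 := ℝ) (m := (m+1, 0)) (k := m+1) (n := 0)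
    le_rfl le_rfl f z
  rw [norm_iteratedFDeriv_zero] at this
  have hz : 0 < 1 + ‖z‖ := by positivity
  rw [Real.rpow_neg hz.le, ← div_eq_mul_inv, le_div_iff₀ (by positivity)]
  have e : (1 + ‖z‖) ^ ((m:ℝ)+1) = (1 + ‖z‖) ^ (m+1) := by
    rw [← Real.rpow_natCast]; push_cast; rfl
  rw [e, mul_comm]
  exact this

lemma integrable_decay (m : ℕ) :
    Integrable fun x : EuclideanSpace ℝ (Fin m) => (1 + ‖x‖) ^ (-((m:ℝ)+1)) := by
  apply integrable_one_add_norm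
  simp

lemma rpow_mono_aux {m : ℕ} {a b : ℝ} (ha : 0 ≤ a) (hab : a ≤ b) :
    (1 + b) ^ (-((m:ℝ)+1)) ≤ (1 + a) ^ (-((m:ℝ)+1)) := by
  have : (0:ℝ) ≤ m := by positivity
  exact Real.rpow_le_rpow_of_nonpos (by positivity) (by linarith) (by linarith)

lemma integrable_trace {m : ℕ} (f : SchwartzMap (EuclideanSpace ℝ (Fin (m+1))) ℂ) :
    Integrable (traceFn (⇑f)) := by
  obtain ⟨B, hB, h⟩ := schwartz_decay (m := m) f
  refine ((integrable_decay m).const_mul B).mono' ?_ (Filter.Eventually.of_forall fun x => ?_)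
  · rw [traceFn_eq]
    exact (f.continuous.comp contDiff_embV.continuous).aestronglyMeasurable
  · rw [traceFn_eq]
    refine (h _).trans ?_
    refine mul_le_mul_of_nonneg_left ?_ hB
    apply rpow_mono_aux (norm_nonneg _)
    have := norm_projV_le (embV x)
    have e : projV (embV x) = x := by ext; simp
    rwa [e] at this

lemma trace_formula {m : ℕ} (f : SchwartzMap (EuclideanSpace ℝ (Fin (m+1))) ℂ)
    (a : SchwartzMap (EuclideanSpace ℝ (Fin m)) ℂ) (x : EuclideanSpace ℝ (Fin m)) :
    𝓕⁻ (fun ξ => a ξ * 𝓕 (traceFn (⇑f)) ξ) x =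
      ∫ ξ, ((Real.fourierChar (inner ℝ ξ (embV x)) : Circle) : ℂ) * (a (projV ξ) * 𝓕 (⇑f) ξ) := by
  rw [fourierInv_mul_fourier a.integrable (integrable_trace f)]
  have hF : ∀ y, f y = ∫ ξ, ((Real.fourierChar (inner ℝ ξ y) : Circle) : ℂ) * 𝓕 (⇑f) ξ := by
    intro y
    have h1 : 𝓕⁻ (𝓕 f) = f := FourierTransform.fourierInv_fourier_eq f
    have h2 := congrArg (fun g : SchwartzMap _ ℂ => g y) h1
    simp only [SchwartzMap.fourierInv_coe, SchwartzMap.fourier_coe] at h2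
    rw [← h2, Real.fourierInv_eq]
    simp only [Circle.smul_def, smul_eq_mul]
  have hA : ∀ y, a y = ∫ ξ, ((Real.fourierChar (inner ℝ ξ y) : Circle) : ℂ) * 𝓕 (⇑a) ξ := by
    intro y
    have h1 : 𝓕⁻ (𝓕 a) = a := FourierTransform.fourierInv_fourier_eq a
    have h2 := congrArg (fun g : SchwartzMap _ ℂ => g y) h1
    simp only [SchwartzMap.fourierInv_coe, SchwartzMap.fourier_coe] at h2
    rw [← h2, Real.fourierInv_eq]
    simp only [Circle.smul_def, smul_eq_mul]
  have ha : Integrable (𝓕 (⇑a)) := (𝓕 a).integrable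
  have hf : Integrable (𝓕 (⇑f)) := (𝓕 f).integrable
  simp only [traceFn_eq]
  calc ∫ y, 𝓕 (⇑a) (y - x) * f (embV y)
      = ∫ y, ∫ ξ, 𝓕 (⇑a) (y - x) * (((Real.fourierChar (inner ℝ ξ (embV y)) : Circle) : ℂ) * 𝓕 (⇑f) ξ) := by
        refine integral_congr_ae (Filter.Eventually.of_forall fun y => ?_)
        dsimp only
        rw [hF, integral_const_mul]
    _ = ∫ ξ, ∫ y, 𝓕 (⇑a) (y - x) * (((Real.fourierChar (inner ℝ ξ (embV y)) : Circle) : ℂ) * 𝓕 (⇑f) ξ) := by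
        refine integral_integral_swap ?_
        have h1 := (ha.comp_sub_right x).mul_prod hf
        refine (h1.bdd_mul (c := 1)
          (f := fun z => ((Real.fourierChar (inner ℝ z.2 (embV z.1)) : Circle) : ℂ)) ?_ ?_).congr ?_
        · apply Continuous.aestronglyMeasurable
          have := (contDiff_embV (m := m)).continuous
          fun_prop
        · exact Filter.Eventually.of_forall fun ξ => (Circle.norm_coe _).le
        · refine Filter.Eventually.of_forall fun z => ?_
          simp [Function.uncurry]
          ring
    _ = _ := by
        refine integral_congr_ae (Filter.Eventually.of_forall fun ξ => ?_)
        dsimp only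
        rw [hA, ← integral_add_right_eq_self _ x, ← integral_mul_const, ← integral_const_mul]
        refine integral_congr_ae (Filter.Eventually.of_forall fun y => ?_)
        dsimp only
        rw [inner_embV, inner_embV, inner_add_right, AddChar.map_add_eq_mul, add_sub_cancel_right,
          real_inner_comm (projV ξ) y]
        push_cast
        ring

/-- The window as a Schwartz function. -/
def winS {η : ℝ → ℝ} (hη : IsBump η) {d : ℕ} (k : Fin d → ℤ) :
    SchwartzMap (EuclideanSpace ℝ (Fin d)) ℂ :=
  HasCompactSupport.toSchwartzMap (f := fun ξ => (unifWindow η k ξ : ℂ))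
    (hasCompactSupport_of_near _ (fun i => (k i : ℝ)) 1 fun ξ h i =>
      (window_ne_zero hη k ξ (by simpa using h) i).le)
    (Complex.ofRealCLM.contDiff.comp (window_contDiff hη k))

/-- The product `ψ_l 𝓕 f` as a Schwartz function. -/
def winMulS {η : ℝ → ℝ} (hη : IsBump η) {d : ℕ} (l : Fin d → ℤ)
    (f : SchwartzMap (EuclideanSpace ℝ (Fin d)) ℂ) : SchwartzMap (EuclideanSpace ℝ (Fin d)) ℂ :=
  HasCompactSupport.toSchwartzMap (f := fun ξ => (unifWindow η l ξ : ℂ) * 𝓕 (⇑f) ξ)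
    (hasCompactSupport_of_near _ (fun i => (l i : ℝ)) 1 fun ξ h i =>
      (window_ne_zero hη l ξ (by simpa using left_ne_zero_of_mul h) i).le)
    (ContDiff.mul (Complex.ofRealCLM.contDiff.comp (window_contDiff hη l))
      (show ContDiff ℝ (⊤ : ℕ∞) (𝓕 (⇑f)) from
        SchwartzMap.smooth (𝓕 f : SchwartzMap (EuclideanSpace ℝ (Fin d)) ℂ) ⊤))

/-- The master multiplier `M(ξ) = ψ_0(ξ̄) η(ξ_n)`. -/
def multF (η : ℝ → ℝ) {m : ℕ} (ξ : EuclideanSpace ℝ (Fin (m+1))) : ℂ :=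
  ((unifWindow η (0 : Fin m → ℤ) (projV ξ) * η (ξ (Fin.last m)) : ℝ) : ℂ)

/-- The master multiplier as a Schwartz function. -/
def multS {η : ℝ → ℝ} (hη : IsBump η) (m : ℕ) : SchwartzMap (EuclideanSpace ℝ (Fin (m+1))) ℂ :=
  HasCompactSupport.toSchwartzMap (f := multF η)
    (hasCompactSupport_of_near _ (fun _ => 0) 2 fun ξ h i => by
      have h' : unifWindow η (0 : Fin m → ℤ) (projV ξ) * η (ξ (Fin.last m)) ≠ 0 := by
        simpa only [multF, ne_eq, Complex.ofReal_eq_zero] using h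
      refine Fin.lastCases ?_ (fun i => ?_) i
      · by_contra hc
        push Not at hc
        apply right_ne_zero_of_mul h'
        apply hη.2.2.2
        simpa using hc.le
      · have := window_ne_zero hη _ _ (left_ne_zero_of_mul h') i
        simp at this ⊢
        linarith)
    (by
      refine Complex.ofRealCLM.contDiff.comp (ContDiff.mul ?_ ?_)
      · exact (window_contDiff hη _).comp contDiff_projV
      · have := hη.1
        fun_prop)

lemma term_formula {η : ℝ → ℝ} (hη : IsBump η) {m : ℕ}
    (f : SchwartzMap (EuclideanSpace ℝ (Fin (m+1))) ℂ) (k : Fin m → ℤ) (l : Fin (m+1) → ℤ)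
    (x : EuclideanSpace ℝ (Fin m)) :
    ‖∫ ξ, (unifWindow η l ξ : ℂ) * (((Real.fourierChar (inner ℝ ξ (embV x)) : Circle) : ℂ) *
        ((unifWindow η k (projV ξ) : ℂ) * 𝓕 (⇑f) ξ))‖ₑ ≤
      ∫⁻ y, ‖(𝓕 (multS hη m)) (y - embV x)‖ₑ * ‖unifBox η l (⇑f) y‖ₑ := by
  set c : EuclideanSpace ℝ (Fin (m+1)) := ivec (Fin.snoc k (l (Fin.last m))) with hc
  set G := winMulS hη l f with hG
  have hg : unifBox η l (⇑f) = ⇑(𝓕⁻ G : SchwartzMap (EuclideanSpace ℝ (Fin (m+1))) ℂ) := by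
    rw [SchwartzMap.fourierInv_coe]; rfl
  have hFg : 𝓕 (unifBox η l (⇑f)) = G := by
    rw [hg, ← SchwartzMap.fourier_coe, FourierTransform.fourier_fourierInv_eq]
  have hgi : Integrable (unifBox η l (⇑f)) := by rw [hg]; exact SchwartzMap.integrable _
  have hai : Integrable (fun ξ => multF η (ξ - c)) :=
    (multS hη m).integrable.comp_sub_right c
  have key : ∫ ξ, (unifWindow η l ξ : ℂ) * (((Real.fourierChar (inner ℝ ξ (embV x)) : Circle) : ℂ) *
        ((unifWindow η k (projV ξ) : ℂ) * 𝓕 (⇑f) ξ)) =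
      ∫ y, (𝓕 (fun ξ => multF η (ξ - c)) : EuclideanSpace ℝ (Fin (m+1)) → ℂ) (y - embV x) * unifBox η l (⇑f) y := by
    rw [← fourierInv_mul_fourier hai hgi, hFg, Real.fourierInv_eq]
    refine integral_congr_ae (Filter.Eventually.of_forall fun ξ => ?_)
    have hGξ : G ξ = (unifWindow η l ξ : ℂ) * 𝓕 (⇑f) ξ := rfl
    simp only [Circle.smul_def, smul_eq_mul]
    rw [hGξ]
    by_cases h0 : unifWindow η l ξ = 0
    · simp [h0]
    · have h1 := window_ne_zero hη l ξ h0 (Fin.last m)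
      have h2 : η (ξ (Fin.last m) - l (Fin.last m)) = 1 := hη.2.2.1 _ h1.le
      have h3 : multF η (ξ - c) = (unifWindow η k (projV ξ) : ℂ) := by
        rw [window_shift η k]
        have e1 : projV (ξ - c) = projV ξ - ivec k := by ext i; simp [hc]
        have e2 : (ξ - c) (Fin.last m) = ξ (Fin.last m) - l (Fin.last m) := by simp [hc]
        rw [multF, e1, e2, h2, mul_one]
      rw [h3]
      ring
  rw [key]
  refine (enorm_integral_le_lintegral_enorm _).trans (le_of_eq ?_)
  refine lintegral_congr fun y => ?_
  rw [enorm_mul]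
  congr 1
  rw [← ofReal_norm, ← ofReal_norm, norm_fourier_translate]
  rfl

lemma box_trace_pointwise {η : ℝ → ℝ} (hη : IsBump η) {m : ℕ}
    (f : SchwartzMap (EuclideanSpace ℝ (Fin (m+1))) ℂ) (k : Fin m → ℤ)
    (x : EuclideanSpace ℝ (Fin m)) :
    ‖unifBox η k (traceFn (⇑f)) x‖ₑ ≤
      ∑' l : {l : Fin (m+1) → ℤ // ∀ i : Fin m, |l i.castSucc - k i| ≤ ((2:ℕ):ℤ)},
        ∫⁻ y, ‖(𝓕 (multS hη m)) (y - embV x)‖ₑ * ‖unifBox η l.1 (⇑f) y‖ₑ := by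
  set H : EuclideanSpace ℝ (Fin (m+1)) → ℂ := fun ξ =>
    ((Real.fourierChar (inner ℝ ξ (embV x)) : Circle) : ℂ) *
        ((unifWindow η k (projV ξ) : ℂ) * 𝓕 (⇑f) ξ) with hH
  have h0 : unifBox η k (traceFn (⇑f)) x = ∫ ξ, H ξ := trace_formula f (winS hη k) x
  have hHi : Integrable H := by
    refine integrable_modul ?_ _
    have hf : Integrable (𝓕 (⇑f)) := (𝓕 f).integrable
    have hc : Continuous fun ξ : EuclideanSpace ℝ (Fin (m+1)) => winS hη k (projV ξ) :=
      (winS hη k).continuous.comp contDiff_projV.continuous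
    obtain ⟨B, hB, h⟩ := schwartz_decay (m := 0) (winS hη k)
    refine hf.bdd_mul (c := B) (f := fun ξ => winS hη k (projV ξ)) hc.aestronglyMeasurable
      (Filter.Eventually.of_forall fun ξ => (h _).trans ?_)
    refine mul_le_of_le_one_right hB (Real.rpow_le_one_of_one_le_of_nonpos ?_ (by simp))
    have := norm_nonneg (projV ξ)
    linarith
  have hwm : ∀ l : Fin (m+1) → ℤ, Continuous fun ξ => (unifWindow η l ξ : ℂ) := fun l =>
    (winS hη l).continuous
  have hsum : ∀ ξ, ∑' l : Fin (m+1) → ℤ, (unifWindow η l ξ : ℂ) * H ξ = H ξ := by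
    intro ξ
    rw [tsum_mul_right, ← Complex.ofReal_tsum, (window_hasSum hη ξ).tsum_eq]
    simp
  have hesum : ∀ ξ, ∑' l : Fin (m+1) → ℤ, ‖(unifWindow η l ξ : ℂ) * H ξ‖ₑ = ‖H ξ‖ₑ := by
    intro ξ
    simp only [enorm_mul]
    rw [ENNReal.tsum_mul_right]
    have : ∀ l : Fin (m+1) → ℤ, ‖(unifWindow η l ξ : ℂ)‖ₑ = ENNReal.ofReal (unifWindow η l ξ) := by
      intro l
      rw [← ofReal_norm, Complex.norm_real, Real.norm_of_nonneg (window_nonneg hη l ξ)]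
    simp only [this]
    rw [← ENNReal.ofReal_tsum_of_nonneg (fun l => window_nonneg hη l ξ) (window_hasSum hη ξ).summable,
      (window_hasSum hη ξ).tsum_eq]
    simp
  have hm : ∀ l : Fin (m+1) → ℤ, AEStronglyMeasurable (fun ξ => (unifWindow η l ξ : ℂ) * H ξ) :=
    fun l => (hwm l).aestronglyMeasurable.mul hHi.aestronglyMeasurable
  have h1 : ∫ ξ, H ξ = ∑' l : Fin (m+1) → ℤ, ∫ ξ, (unifWindow η l ξ : ℂ) * H ξ := by
    rw [← integral_tsum hm]
    · simp only [hsum]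
    · rw [← lintegral_tsum fun l => (hm l).enorm]
      simp only [hesum]
      exact hHi.2.ne
  rw [h0, h1]
  refine enorm_tsum_le_tsum_enorm.trans ?_
  have hsupp : Function.support (fun l : Fin (m+1) → ℤ => ‖∫ ξ, (unifWindow η l ξ : ℂ) * H ξ‖ₑ) ⊆
      {l | ∀ i : Fin m, |l i.castSucc - k i| ≤ ((2:ℕ):ℤ)} := by
    intro l hl i
    by_contra hc
    apply hl
    have : ∀ ξ, (unifWindow η l ξ : ℂ) * H ξ = 0 := by
      intro ξ
      by_contra hne
      have a1 : unifWindow η l ξ ≠ 0 := by simpa using left_ne_zero_of_mul hne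
      have a2 : unifWindow η k (projV ξ) ≠ 0 := by
        have := left_ne_zero_of_mul (right_ne_zero_of_mul (right_ne_zero_of_mul hne))
        simpa using this
      have b1 := abs_lt.1 (window_ne_zero hη l ξ a1 i.castSucc)
      have b2 := abs_lt.1 (window_ne_zero hη k _ a2 i)
      rw [projV_apply] at b2
      apply hc
      have : |(l i.castSucc : ℝ) - k i| ≤ 2 := by
        rw [abs_le]; constructor <;> linarith
      exact_mod_cast this
    simp [this]
  rw [← tsum_subtype_eq_of_support_subset hsupp]
  exact ENNReal.tsum_le_tsum fun l => term_formula hη f k l.1 x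

lemma kernel_bound {m : ℕ} (κ : SchwartzMap (EuclideanSpace ℝ (Fin (m+1))) ℂ) :
    ∃ A : ℝ≥0∞, A ≠ ∞ ∧ (∀ x : EuclideanSpace ℝ (Fin m), ∫⁻ y, ‖κ (y - embV x)‖ₑ ≤ A) ∧
      ∀ y, ∫⁻ x : EuclideanSpace ℝ (Fin m), ‖κ (y - embV x)‖ₑ ≤ A := by
  obtain ⟨B, hB, hdec⟩ := schwartz_decay (m := m) κ
  have hA1t : ∫⁻ y, ‖κ y‖ₑ ≠ ∞ := κ.integrable.2.ne
  have hA2t : ∫⁻ x : EuclideanSpace ℝ (Fin m), ‖B * (1 + ‖x‖) ^ (-((m:ℝ)+1))‖ₑ ≠ ∞ :=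
    ((integrable_decay m).const_mul B).2.ne
  refine ⟨_, ENNReal.add_ne_top.2 ⟨hA1t, hA2t⟩, fun x => ?_, fun y => ?_⟩
  · rw [lintegral_sub_right_eq_self (fun y => ‖κ y‖ₑ)]
    exact le_self_add
  · refine le_trans ?_ le_add_self
    rw [← lintegral_sub_left_eq_self (fun x : EuclideanSpace ℝ (Fin m) =>
      ‖B * (1 + ‖x‖) ^ (-((m:ℝ)+1))‖ₑ) (projV y)]
    refine lintegral_mono fun x => ?_
    refine enorm_le_iff_norm_le.2 ?_
    have h1 : ‖projV y - x‖ ≤ ‖y - embV x‖ := by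
      rw [← projV_sub_embV]
      exact norm_projV_le _
    have h2 := mul_le_mul_of_nonneg_left (rpow_mono_aux (m := m) (norm_nonneg _) h1) hB
    exact (hdec _).trans (h2.trans (le_abs_self _))

lemma kernel_measurable {m : ℕ} (κ : SchwartzMap (EuclideanSpace ℝ (Fin (m+1))) ℂ) :
    Measurable (Function.uncurry fun (x : EuclideanSpace ℝ (Fin m))
      (y : EuclideanSpace ℝ (Fin (m+1))) => ‖κ (y - embV x)‖ₑ) := by
  have h1 := (contDiff_embV (m := m)).continuous
  have h2 := κ.continuous
  exact (continuous_enorm.comp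
    (h2.comp (continuous_snd.sub (h1.comp continuous_fst)))).measurable

lemma box_measurable {η : ℝ → ℝ} (hη : IsBump η) {d : ℕ}
    (f : SchwartzMap (EuclideanSpace ℝ (Fin d)) ℂ) (l : Fin d → ℤ) :
    Measurable fun y => ‖unifBox η l (⇑f) y‖ₑ := by
  have hg : unifBox η l (⇑f) =
      ⇑(𝓕⁻ (winMulS hη l f) : SchwartzMap (EuclideanSpace ℝ (Fin d)) ℂ) := by
    rw [SchwartzMap.fourierInv_coe]; rfl
  rw [hg]
  exact (continuous_enorm.comp (SchwartzMap.continuous _)).measurable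

lemma convol_measurable {m : ℕ} (κ : SchwartzMap (EuclideanSpace ℝ (Fin (m+1))) ℂ)
    (g : EuclideanSpace ℝ (Fin (m+1)) → ℝ≥0∞) (hg : Measurable g) :
    Measurable fun x : EuclideanSpace ℝ (Fin m) => ∫⁻ y, ‖κ (y - embV x)‖ₑ * g y :=
  Measurable.lintegral_prod_right'
    (f := fun z : EuclideanSpace ℝ (Fin m) × EuclideanSpace ℝ (Fin (m+1)) =>
      ‖κ (z.2 - embV z.1)‖ₑ * g z.2)
    ((kernel_measurable κ).mul (hg.comp measurable_snd))

lemma final_step {m : ℕ} (k : Fin m → ℤ) {p : ℝ≥0∞} (hp : 1 ≤ p)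
    (w : (Fin (m+1) → ℤ) → EuclideanSpace ℝ (Fin m) → ℝ≥0∞) (hw : ∀ l, Measurable (w l)) :
    eLpNorm (fun x => ∑' l : {l : Fin (m+1) → ℤ // ∀ i : Fin m, |l i.castSucc - k i| ≤ ((2:ℕ):ℤ)},
      w l.1 x) p volume ≤
    ∑' l : {l : Fin (m+1) → ℤ // ∀ i : Fin m, |l i.castSucc - k i| ≤ ((2:ℕ):ℤ)},
      eLpNorm (w l.1) p volume :=
  eLpNorm_tsum_le_aux (μ := volume) (fun (l : {l : Fin (m+1) → ℤ //
    ∀ i : Fin m, |l i.castSucc - k i| ≤ ((2:ℕ):ℤ)}) => w l.1) (fun l => hw l.1) hp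

lemma final_aux {m : ℕ} {η : ℝ → ℝ} (hη : IsBump η) {p : ℝ≥0∞} (hp : 1 ≤ p)
    (κ : SchwartzMap (EuclideanSpace ℝ (Fin (m+1))) ℂ) (A : ℝ≥0∞) (hAt : A ≠ ∞)
    (hK1 : ∀ x : EuclideanSpace ℝ (Fin m), ∫⁻ y, ‖κ (y - embV x)‖ₑ ≤ A)
    (hK2 : ∀ y, ∫⁻ x : EuclideanSpace ℝ (Fin m), ‖κ (y - embV x)‖ₑ ≤ A)
    (f : SchwartzMap (EuclideanSpace ℝ (Fin (m+1))) ℂ) (k : Fin m → ℤ)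
    (hpt : ∀ x, ‖unifBox η k (traceFn (⇑f)) x‖ₑ ≤
      ∑' l : {l : Fin (m+1) → ℤ // ∀ i : Fin m, |l i.castSucc - k i| ≤ ((2:ℕ):ℤ)},
        ∫⁻ y, ‖κ (y - embV x)‖ₑ * ‖unifBox η l.1 (⇑f) y‖ₑ) :
    eLpNorm (unifBox η k (traceFn (⇑f))) p volume ≤
      (A + 1) * ∑' l : {l : Fin (m+1) → ℤ // ∀ i : Fin m, |l i.castSucc - k i| ≤ ((2:ℕ):ℤ)},
        eLpNorm (unifBox η l.1 (⇑f)) p volume := by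
  have hvm : ∀ l : Fin (m+1) → ℤ, Measurable fun x : EuclideanSpace ℝ (Fin m) =>
      ∫⁻ y, ‖κ (y - embV x)‖ₑ * ‖unifBox η l (⇑f) y‖ₑ := by
    intro l
    have h := box_measurable hη f l
    exact convol_measurable (m := m) κ (fun y => ‖unifBox η l (⇑f) y‖ₑ) h
  calc eLpNorm (unifBox η k (traceFn (⇑f))) p volume
      ≤ eLpNorm (fun x => ∑' l : {l : Fin (m+1) → ℤ // ∀ i : Fin m, |l i.castSucc - k i| ≤ ((2:ℕ):ℤ)},
        ∫⁻ y, ‖κ (y - embV x)‖ₑ * ‖unifBox η l.1 (⇑f) y‖ₑ) p volume := by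
        refine eLpNorm_mono_enorm fun x => ?_
        rw [enorm_eq_self]
        exact hpt x
    _ ≤ ∑' l : {l : Fin (m+1) → ℤ // ∀ i : Fin m, |l i.castSucc - k i| ≤ ((2:ℕ):ℤ)},
        eLpNorm (fun x => ∫⁻ y, ‖κ (y - embV x)‖ₑ * ‖unifBox η l.1 (⇑f) y‖ₑ) p volume :=
        final_step k hp (fun l x => ∫⁻ y, ‖κ (y - embV x)‖ₑ * ‖unifBox η l (⇑f) y‖ₑ) hvm
    _ ≤ ∑' l : {l : Fin (m+1) → ℤ // ∀ i : Fin m, |l i.castSucc - k i| ≤ ((2:ℕ):ℤ)},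
        (A + 1) * eLpNorm (unifBox η l.1 (⇑f)) p volume := by
        refine ENNReal.tsum_le_tsum fun l => ?_
        refine (schur_aux (fun (x : EuclideanSpace ℝ (Fin m))
          (y : EuclideanSpace ℝ (Fin (m+1))) => ‖κ (y - embV x)‖ₑ) (kernel_measurable κ)
          (fun y => ‖unifBox η l.1 (⇑f) y‖ₑ) (box_measurable hη f l.1) hp A hAt hK1 hK2).trans ?_
        rw [eLpNorm_enorm]
        gcongr
        exact le_self_add
    _ = _ := ENNReal.tsum_mul_left

/-- For `n = m+1 ≥ 2` and `1 ≤ p ≤ ∞` there exist `N` and `C` such that for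
every Schwartz `f` and every `k̄ ∈ ℤ^{n-1}`,
`‖□_{k̄}(Tr f)‖_{L^p(ℝ^{n-1})} ≤ C Σ_{l : |l̄-k̄|_∞ ≤ N} ‖□_l f‖_{L^p(ℝⁿ)}`. -/
theorem box_trace_le_sum_box
    (m : ℕ) (hm : 1 ≤ m) (η : ℝ → ℝ) (hη : IsBump η)
    (p : ℝ≥0∞) (hp : 1 ≤ p) :
    ∃ (N : ℕ) (C : ℝ≥0∞), 0 < C ∧ C ≠ ∞ ∧
      ∀ (f : SchwartzMap (EuclideanSpace ℝ (Fin (m+1))) ℂ) (k : Fin m → ℤ),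
        eLpNorm (unifBox η k (traceFn (⇑f))) p volume ≤
          C * ∑' l : {l : Fin (m+1) → ℤ // ∀ i : Fin m, |l i.castSucc - k i| ≤ (N:ℤ)},
            eLpNorm (unifBox η l.1 (⇑f)) p volume := by
  obtain ⟨A, hAt, hK1, hK2⟩ := kernel_bound (𝓕 (multS hη m))
  exact ⟨2, A + 1, by simp, ENNReal.add_ne_top.2 ⟨hAt, ENNReal.one_ne_top⟩, fun f k =>
    final_aux hη hp _ A hAt hK1 hK2 f k (box_trace_pointwise hη f k)⟩
end
end
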